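/- arXiv:1706.01873 — 2 statements merged into one kernel-verified Lean document; each statement's English description precedes it below -/
import Mathlib

section
/- Let A ⊂ X and x ∈ X∖A. If A is 1-thin at x, then there exists an open set W ⊃ A that is 1-thin at x. -/
open MeasureTheory Metric Filter Set
open scoped ENNReal NNReal Topology

noncomputable section

namespace MetricBV

variable {X : Type*} [MetricSpace X] [MeasurableSpace X]

/-- A rectifiable curve, encoded as a Lipschitz map on the interval `[0,1]`
(every rectifiable curve admits such a reparametrization). -/
structure Curve (X : Type*) [MetricSpace X] where
  toFun : ℝ → X
  lipschitz : ∃ K : ℝ≥0, LipschitzOnWith K toFun (Set.Icc 0 1)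

/-- The metric speed of a curve at a point. -/
def speed (γ : ℝ → X) (t : ℝ) : ℝ≥0∞ :=
  Filter.limsup (fun h : ℝ => ENNReal.ofReal (dist (γ (t + h)) (γ t) / |h|)) (𝓝[≠] (0 : ℝ))

/-- The curve integral `∫_γ g ds`. -/
def curveIntegral (g : X → ℝ≥0∞) (γ : Curve X) : ℝ≥0∞ :=
  ∫⁻ t in Set.Icc (0 : ℝ) 1, g (γ.toFun t) * speed γ.toFun t

/-- A curve lies in a set `Ω`. -/
def Curve.In (γ : Curve X) (Ω : Set X) : Prop :=
  ∀ t ∈ Set.Icc (0 : ℝ) 1, γ.toFun t ∈ Ω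

/-- The 1-modulus of a family of curves. -/
def Mod1 (μ : Measure X) (Γ : Set (Curve X)) : ℝ≥0∞ :=
  ⨅ (ρ : X → ℝ≥0∞) (_ : Measurable ρ) (_ : ∀ γ ∈ Γ, 1 ≤ curveIntegral ρ γ),
    ∫⁻ x, ρ x ∂μ

/-- `g` is an upper gradient of `u` in `Ω`: the upper gradient inequality holds
along every curve contained in `Ω`. -/
def IsUpperGradientOn (g : X → ℝ≥0∞) (u : X → ℝ) (Ω : Set X) : Prop :=
  ∀ γ : Curve X, γ.In Ω →
    ENNReal.ofReal |u (γ.toFun 1) - u (γ.toFun 0)| ≤ curveIntegral g γ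

/-- `g` is a 1-weak upper gradient of `u` in `Ω`: the upper gradient inequality holds
along every curve in `Ω` outside a family of zero 1-modulus. -/
def IsWeakUpperGradientOn (μ : Measure X) (g : X → ℝ≥0∞) (u : X → ℝ) (Ω : Set X) : Prop :=
  ∃ Γ : Set (Curve X), Mod1 μ Γ = 0 ∧
    ∀ γ : Curve X, γ ∉ Γ → γ.In Ω →
      ENNReal.ofReal |u (γ.toFun 1) - u (γ.toFun 0)| ≤ curveIntegral g γ

/-- Membership in the Newtonian space `N^{1,1}(X)`. -/
def MemN11 (μ : Measure X) (u : X → ℝ) : Prop :=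
  Integrable u μ ∧ ∃ g : X → ℝ≥0∞, Measurable g ∧
    IsWeakUpperGradientOn μ g u Set.univ ∧ ∫⁻ x, g x ∂μ < ⊤

/-- The 1-capacity `cap₁(A) = inf ‖u‖_{N^{1,1}(X)}` over `u ∈ N^{1,1}(X)` with `u ≥ 1` on `A`. -/
def cap1 (μ : Measure X) (A : Set X) : ℝ≥0∞ :=
  ⨅ (u : X → ℝ) (_ : MemN11 μ u) (_ : ∀ x ∈ A, 1 ≤ u x)
    (g : X → ℝ≥0∞) (_ : Measurable g) (_ : IsWeakUpperGradientOn μ g u Set.univ),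
    (∫⁻ x, ENNReal.ofReal |u x| ∂μ + ∫⁻ x, g x ∂μ)

/-- The variational 1-capacity `cap₁(A,Ω) = inf ∫ g_u dμ` over `u ∈ N^{1,1}(X)` with
`u ≥ 1` on `A` and `u = 0` on `X ∖ Ω`. -/
def vcap1 (μ : Measure X) (A Ω : Set X) : ℝ≥0∞ :=
  ⨅ (u : X → ℝ) (_ : MemN11 μ u) (_ : ∀ x ∈ A, 1 ≤ u x) (_ : ∀ x ∈ Ωᶜ, u x = 0)
    (g : X → ℝ≥0∞) (_ : Measurable g) (_ : IsWeakUpperGradientOn μ g u Set.univ),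
    ∫⁻ x, g x ∂μ

/-- Locally Lipschitz in `Ω`: Lipschitz on every compact subset of `Ω`. -/
def LocLipschitzOn (u : X → ℝ) (Ω : Set X) : Prop :=
  ∀ K : Set X, IsCompact K → K ⊆ Ω → ∃ L : ℝ≥0, LipschitzOnWith L u K

/-- Convergence `v i → u` in `L¹_loc(Ω)`. -/
def TendstoL1Loc (μ : Measure X) (v : ℕ → X → ℝ) (u : X → ℝ) (Ω : Set X) : Prop :=
  ∀ K : Set X, IsCompact K → K ⊆ Ω →
    Filter.Tendsto (fun i => ∫⁻ x in K, ENNReal.ofReal |v i x - u x| ∂μ)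
      Filter.atTop (𝓝 0)

/-- The total variation `‖Du‖(Ω)` of `u` in an open set `Ω`: the infimum of
`liminf ∫_Ω g_i dμ` over sequences of locally Lipschitz functions `v i → u` in `L¹_loc(Ω)`
with `g i` a 1-weak upper gradient of `v i` in `Ω`. -/
def tv (μ : Measure X) (u : X → ℝ) (Ω : Set X) : ℝ≥0∞ :=
  ⨅ (v : ℕ → X → ℝ) (_ : ∀ i, LocLipschitzOn (v i) Ω) (_ : TendstoL1Loc μ v u Ω)
    (g : ℕ → X → ℝ≥0∞) (_ : ∀ i, Measurable (g i))
    (_ : ∀ i, IsWeakUpperGradientOn μ (g i) (v i) Ω),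
    Filter.liminf (fun i => ∫⁻ x in Ω, g i x ∂μ) Filter.atTop

/-- The total variation `‖Du‖(A)` for an arbitrary set `A`. -/
def tvs (μ : Measure X) (u : X → ℝ) (A : Set X) : ℝ≥0∞ :=
  ⨅ (U : Set X) (_ : IsOpen U) (_ : A ⊆ U), tv μ u U

/-- The characteristic function of a set, as a real-valued function. -/
def chi (E : Set X) : X → ℝ := Set.indicator E fun _ => (1 : ℝ)

/-- The perimeter `P(E,Ω) = ‖Dχ_E‖(Ω)` of `E` in an open set `Ω`. -/
def perim (μ : Measure X) (E : Set X) (Ω : Set X) : ℝ≥0∞ := tv μ (chi E) Ω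

/-- `u ∈ BV(Ω)`: `u ∈ L¹(Ω)` and `‖Du‖(Ω) < ∞`. -/
def MemBV (μ : Measure X) (u : X → ℝ) (Ω : Set X) : Prop :=
  IntegrableOn u Ω μ ∧ tv μ u Ω < ⊤

/-- `u ∈ BV_loc(Ω)`. -/
def MemBVloc (μ : Measure X) (u : X → ℝ) (Ω : Set X) : Prop :=
  ∀ K : Set X, IsCompact K → K ⊆ Ω → ∃ U : Set X, IsOpen U ∧ K ⊆ U ∧ U ⊆ Ω ∧ MemBV μ u U

/-- `φ ∈ BV_c(Ω)`: a BV function with compact support in `Ω`. -/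
def MemBVc (μ : Measure X) (φ : X → ℝ) (Ω : Set X) : Prop :=
  MemBV μ φ Ω ∧ IsCompact (tsupport φ) ∧ tsupport φ ⊆ Ω

/-- `u` is a 1-minimizer (function of least gradient) in `Ω`. -/
def IsMinimizer (μ : Measure X) (u : X → ℝ) (Ω : Set X) : Prop :=
  MemBVloc μ u Ω ∧ ∀ φ : X → ℝ, MemBVc μ φ Ω →
    tvs μ u (tsupport φ) ≤ tvs μ (fun y => u y + φ y) (tsupport φ)

/-- `u` is a 1-superminimizer in `Ω`. -/
def IsSuperminimizer (μ : Measure X) (u : X → ℝ) (Ω : Set X) : Prop :=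
  MemBVloc μ u Ω ∧ ∀ φ : X → ℝ, MemBVc μ φ Ω → (∀ x, 0 ≤ φ x) →
    tvs μ u (tsupport φ) ≤ tvs μ (fun y => u y + φ y) (tsupport φ)

/-- `u` is a 1-subminimizer in `Ω`. -/
def IsSubminimizer (μ : Measure X) (u : X → ℝ) (Ω : Set X) : Prop :=
  MemBVloc μ u Ω ∧ ∀ φ : X → ℝ, MemBVc μ φ Ω → (∀ x, φ x ≤ 0) →
    tvs μ u (tsupport φ) ≤ tvs μ (fun y => u y + φ y) (tsupport φ)

/-- The lower approximate limit `u^∧(x)`, with values in `[-∞,∞]`. -/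
def lowerApprox (μ : Measure X) (u : X → ℝ) (x : X) : EReal :=
  sSup ((fun t : ℝ => (t : EReal)) '' {t : ℝ | Filter.Tendsto
    (fun r : ℝ => μ ({y | u y < t} ∩ Metric.ball x r) / μ (Metric.ball x r))
    (𝓝[>] (0 : ℝ)) (𝓝 0)})

/-- The upper approximate limit `u^∨(x)`, with values in `[-∞,∞]`. -/
def upperApprox (μ : Measure X) (u : X → ℝ) (x : X) : EReal :=
  sInf ((fun t : ℝ => (t : EReal)) '' {t : ℝ | Filter.Tendsto
    (fun r : ℝ => μ ({y | t < u y} ∩ Metric.ball x r) / μ (Metric.ball x r))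
    (𝓝[>] (0 : ℝ)) (𝓝 0)})

/-- The upper approximate limit of an extended-real-valued function. -/
def upperApproxE (μ : Measure X) (ψ : X → EReal) (x : X) : EReal :=
  sInf ((fun t : ℝ => (t : EReal)) '' {t : ℝ | Filter.Tendsto
    (fun r : ℝ => μ ({y | (t : EReal) < ψ y} ∩ Metric.ball x r) / μ (Metric.ball x r))
    (𝓝[>] (0 : ℝ)) (𝓝 0)})

/-- The measure-theoretic interior `I_E`. -/
def measInterior (μ : Measure X) (E : Set X) : Set X :=
  {x : X | Filter.Tendsto (fun r : ℝ => μ (Metric.ball x r \ E) / μ (Metric.ball x r))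
    (𝓝[>] (0 : ℝ)) (𝓝 0)}

/-- The measure-theoretic boundary `∂*E`. -/
def measBoundary (μ : Measure X) (E : Set X) : Set X :=
  {x : X | 0 < Filter.limsup (fun r : ℝ => μ (Metric.ball x r ∩ E) / μ (Metric.ball x r))
      (𝓝[>] (0 : ℝ)) ∧
    0 < Filter.limsup (fun r : ℝ => μ (Metric.ball x r \ E) / μ (Metric.ball x r))
      (𝓝[>] (0 : ℝ))}

/-- `A` is 1-thin at `x`. -/
def IsThinAt (μ : Measure X) (A : Set X) (x : X) : Prop :=
  Filter.Tendsto (fun r : ℝ =>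
      ENNReal.ofReal r * vcap1 μ (A ∩ Metric.ball x r) (Metric.ball x (2 * r))
        / μ (Metric.ball x r))
    (𝓝[>] (0 : ℝ)) (𝓝 0)

/-- `U` is 1-finely open. -/
def IsFinelyOpen (μ : Measure X) (U : Set X) : Prop :=
  ∀ x ∈ U, IsThinAt μ Uᶜ x

/-- The class `K_{ψ,f}(Ω)` of admissible functions for the obstacle problem. -/
def MemK (μ : Measure X) (ψ : X → EReal) (f : X → ℝ) (Ω : Set X) (u : X → ℝ) : Prop :=
  MemBVloc μ u Set.univ ∧ (∀ᵐ x ∂μ, x ∈ Ω → ψ x ≤ (u x : EReal)) ∧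
    (∀ᵐ x ∂μ, x ∉ Ω → u x = f x)

/-- `u` is a solution of the `K_{ψ,f}(Ω)`-obstacle problem. -/
def IsObstacleSolution (μ : Measure X) (ψ : X → EReal) (f : X → ℝ) (Ω : Set X)
    (u : X → ℝ) : Prop :=
  MemK μ ψ f Ω u ∧ ∀ v : X → ℝ, MemK μ ψ f Ω v → tv μ u Set.univ ≤ tv μ v Set.univ

/-- The standing assumptions: `(X,d,μ)` is a complete metric space with at least two points,
`μ` is a doubling measure with constant `Cd`, and `X` supports a `(1,1)`-Poincaré inequality
with constants `CP`, `lam`. -/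
structure MMS {X : Type*} [MetricSpace X] [MeasurableSpace X] (μ : Measure X)
    (Cd CP lam : ℝ) : Prop where
  complete : CompleteSpace X
  nontrivial : Nontrivial X
  hCd : 1 ≤ Cd
  hCP : 0 < CP
  hlam : 1 ≤ lam
  doubling : ∀ (x : X) (r : ℝ), 0 < r →
    0 < μ (Metric.ball x (2 * r)) ∧
    μ (Metric.ball x (2 * r)) ≤ ENNReal.ofReal Cd * μ (Metric.ball x r) ∧
    μ (Metric.ball x r) < ⊤
  poincare : ∀ (x : X) (r : ℝ), 0 < r → ∀ u : X → ℝ, MeasureTheory.LocallyIntegrable u μ →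
    ∀ g : X → ℝ≥0∞, Measurable g → IsUpperGradientOn g u Set.univ →
      ∫⁻ y in Metric.ball x r, ENNReal.ofReal |u y - ⨍ z in Metric.ball x r, u z ∂μ| ∂μ ≤
        ENNReal.ofReal (CP * r) * (μ (Metric.ball x r) / μ (Metric.ball x (lam * r))) *
          ∫⁻ y in Metric.ball x (lam * r), g y ∂μ


/-- A Lipschitz function on `[0,1]` is controlled by the integral of any bound for its
derivative. -/
lemma abs_sub_le_lintegral_of_deriv_bound {f : ℝ → ℝ} {K : ℝ≥0}
    (hf : LipschitzOnWith K f (Icc 0 1)) {G : ℝ → ℝ≥0∞}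
    (h : ∀ t ∈ Ioo (0 : ℝ) 1, ∀ d, HasDerivAt f d t → ENNReal.ofReal |d| ≤ G t) :
    ENNReal.ofReal |f 1 - f 0| ≤ ∫⁻ t in Icc (0 : ℝ) 1, G t := by
  have hac : AbsolutelyContinuousOnInterval f 0 1 :=
    LipschitzOnWith.absolutelyContinuousOnInterval (K := K) (by simpa using hf)
  rw [← hac.integral_deriv_eq_sub, intervalIntegral.integral_of_le zero_le_one,
    ← Real.norm_eq_abs, ofReal_norm]
  refine (enorm_integral_le_lintegral_enorm _).trans ?_
  rw [← restrict_Ioo_eq_restrict_Icc, ← restrict_Ioo_eq_restrict_Ioc]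
  have hd := hac.boundedVariationOn.ae_differentiableAt_of_mem_uIcc
  refine lintegral_mono_ae ((ae_restrict_iff' measurableSet_Ioo).2 ?_)
  filter_upwards [hd] with t ht htm
  have := h t htm _ (ht (by simpa using Ioo_subset_Icc_self htm)).hasDerivAt
  rwa [← ofReal_norm, Real.norm_eq_abs]

omit [MeasurableSpace X] in
lemma Curve.continuousAt (γ : Curve X) {t : ℝ} (ht : t ∈ Ioo (0 : ℝ) 1) :
    ContinuousAt γ.toFun t := by
  obtain ⟨K, hK⟩ := γ.lipschitz
  exact hK.continuousOn.continuousAt (Icc_mem_nhds ht.1 ht.2)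

omit [MeasurableSpace X] in
/-- The derivative of a function along a curve is at most a local Lipschitz constant times
the speed. -/
lemma ofReal_abs_deriv_le_mul_speed {v : X → ℝ} {γ : ℝ → X} {t d c : ℝ} (hc : 0 ≤ c)
    (hd : HasDerivAt (fun s => v (γ s)) d t)
    (h : ∀ᶠ s in 𝓝 t, |v (γ s) - v (γ t)| ≤ c * dist (γ s) (γ t)) :
    ENNReal.ofReal |d| ≤ ENNReal.ofReal c * speed γ t := by
  have h1 : Tendsto (fun h : ℝ => ENNReal.ofReal |h⁻¹ • (v (γ (t + h)) - v (γ t))|) (𝓝[≠] 0)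
      (𝓝 (ENNReal.ofReal |d|)) :=
    ENNReal.tendsto_ofReal hd.tendsto_slope_zero.abs
  rw [← h1.limsup_eq, speed, ← ENNReal.limsup_const_mul_of_ne_top ENNReal.ofReal_ne_top]
  refine limsup_le_limsup ?_
  have h2 : Tendsto (fun h : ℝ => t + h) (𝓝[≠] 0) (𝓝 t) := by
    have : Tendsto (fun h : ℝ => t + h) (𝓝 0) (𝓝 (t + 0)) :=
      (continuous_const.add continuous_id).tendsto 0
    rw [add_zero] at this
    exact this.mono_left nhdsWithin_le_nhds
  filter_upwards [h2.eventually h] with s hs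
  rw [← ENNReal.ofReal_mul hc]
  refine ENNReal.ofReal_le_ofReal ?_
  rw [smul_eq_mul, abs_mul, abs_inv, inv_mul_eq_div, mul_div_assoc']
  gcongr

omit [MeasurableSpace X] in
/-- A function which is Lipschitz at small scales with local constant `φ` has as upper gradient
any function dominating `φ` off the zero set of the function. -/
lemma isUpperGradientOn_of_local {v : X → ℝ} (hv0 : ∀ y, 0 ≤ v y) (hv1 : ∀ y, v y ≤ 1)
    {ρ : ℝ} (hρ : 0 < ρ) {φ : X → ℝ} {M : ℝ} (hφ0 : ∀ y, 0 ≤ φ y) (hφM : ∀ y, φ y ≤ M)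
    (h : ∀ y z, dist y z < ρ → |v y - v z| ≤ φ y * dist y z)
    {G : X → ℝ≥0∞} (hG : ∀ y, v y ≠ 0 → ENNReal.ofReal (φ y) ≤ G y) :
    IsUpperGradientOn G v univ := by
  intro γ _
  obtain ⟨K, hK⟩ := γ.lipschitz
  obtain ⟨C, hC⟩ : ∃ C : ℝ≥0, LipschitzOnWith C (fun t => v (γ.toFun t)) (Icc 0 1) := by
    refine ⟨Real.toNNReal (M * K) + Real.toNNReal (K / ρ), LipschitzOnWith.of_dist_le_mul ?_⟩
    intro s hs t ht
    have hd := hK.dist_le_mul s hs t ht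
    have h1 : M * K ≤ (Real.toNNReal (M * K) : ℝ) := Real.le_coe_toNNReal _
    have h2 : K / ρ ≤ (Real.toNNReal (K / ρ) : ℝ) := Real.le_coe_toNNReal _
    have h3 : (0 : ℝ) ≤ Real.toNNReal (M * K) := NNReal.coe_nonneg _
    have h4 : (0 : ℝ) ≤ Real.toNNReal (K / ρ) := NNReal.coe_nonneg _
    rw [Real.dist_eq, NNReal.coe_add, add_mul]
    by_cases hc : dist (γ.toFun s) (γ.toFun t) < ρ
    · calc |v (γ.toFun s) - v (γ.toFun t)| ≤ φ (γ.toFun s) * dist (γ.toFun s) (γ.toFun t) :=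
            h _ _ hc
        _ ≤ M * (K * dist s t) := by
            have := (hφ0 (γ.toFun s)).trans (hφM _)
            gcongr
            exact hφM _
        _ = M * K * dist s t := by ring
        _ ≤ Real.toNNReal (M * K) * dist s t := by gcongr
        _ ≤ _ := le_add_of_nonneg_right (by positivity)
    · push Not at hc
      calc |v (γ.toFun s) - v (γ.toFun t)| ≤ 1 := by
            rw [abs_le]
            constructor <;> linarith [hv0 (γ.toFun s), hv0 (γ.toFun t), hv1 (γ.toFun s),
              hv1 (γ.toFun t)]
        _ ≤ K / ρ * dist s t := by
            rw [div_mul_eq_mul_div, le_div_iff₀ hρ]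
            linarith
        _ ≤ Real.toNNReal (K / ρ) * dist s t := by gcongr
        _ ≤ _ := le_add_of_nonneg_left (by positivity)
  refine abs_sub_le_lintegral_of_deriv_bound hC fun t ht d hd => ?_
  by_cases hz : v (γ.toFun t) = 0
  · have hmin : IsLocalMin (fun s => v (γ.toFun s)) t :=
      Eventually.of_forall fun s => by simpa [hz] using hv0 (γ.toFun s)
    simp [hmin.hasDerivAt_eq_zero hd]
  · have hev : ∀ᶠ s in 𝓝 t, |v (γ.toFun s) - v (γ.toFun t)|
        ≤ φ (γ.toFun t) * dist (γ.toFun s) (γ.toFun t) := by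
      filter_upwards [(γ.continuousAt ht).eventually (ball_mem_nhds _ hρ)] with s hs
      rw [abs_sub_comm, dist_comm]
      exact h _ _ (by rw [dist_comm]; exact hs)
    refine (ofReal_abs_deriv_le_mul_speed (hφ0 _) hd hev).trans ?_
    gcongr
    exact hG _ hz

/-- The cost of the first `n` steps of the discrete chain `p` with respect to the density `φ`. -/
def chainCost (φ : X → ℝ) (p : ℕ → X) (n : ℕ) : ℝ :=
  ∑ i ∈ Finset.range n, min (φ (p i)) (φ (p (i + 1))) * dist (p i) (p (i + 1))

/-- The costs of the `ρ`-chains connecting `y` to the complement of `Ω`. -/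
def chainCosts (φ : X → ℝ) (ρ : ℝ) (Ω : Set X) (y : X) : Set ℝ :=
  {c | ∃ (n : ℕ) (p : ℕ → X), p 0 = y ∧ p n ∉ Ω ∧ (∀ i < n, dist (p i) (p (i + 1)) < ρ) ∧
    chainCost φ p n = c}

/-- The least cost of a `ρ`-chain connecting `y` to the complement of `Ω`, truncated at `1`. -/
def chainInf (φ : X → ℝ) (ρ : ℝ) (Ω : Set X) (y : X) : ℝ :=
  sInf (insert 1 (chainCosts φ ρ Ω y))

section Chain

variable {φ : X → ℝ} {ρ : ℝ} {Ω : Set X}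

omit [MeasurableSpace X]

lemma chainCost_succ (p : ℕ → X) (n : ℕ) : chainCost φ p (n + 1) =
    chainCost φ p n + min (φ (p n)) (φ (p (n + 1))) * dist (p n) (p (n + 1)) :=
  Finset.sum_range_succ _ _

lemma chainCost_nonneg (hφ : ∀ y, 0 ≤ φ y) (p : ℕ → X) (n : ℕ) : 0 ≤ chainCost φ p n :=
  Finset.sum_nonneg fun _ _ => mul_nonneg (le_min (hφ _) (hφ _)) dist_nonneg

lemma chainCost_mono (hφ : ∀ y, 0 ≤ φ y) (p : ℕ → X) : Monotone (chainCost φ p) :=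
  monotone_nat_of_le_succ fun n => by
    rw [chainCost_succ]
    exact le_add_of_nonneg_right (mul_nonneg (le_min (hφ _) (hφ _)) dist_nonneg)

lemma mul_dist_le_chainCost_sub {p : ℕ → X} {m : ℝ} (hm : 0 ≤ m) {i j : ℕ} (hij : i ≤ j)
    (h : ∀ l, i ≤ l → l ≤ j → m ≤ φ (p l)) :
    m * dist (p i) (p j) ≤ chainCost φ p j - chainCost φ p i := by
  induction j, hij using Nat.le_induction with
  | base => simp
  | succ j hij ih =>
    have h1 := ih fun l hl hlj => h l hl (hlj.trans (Nat.le_succ _))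
    have h2 : m ≤ min (φ (p j)) (φ (p (j + 1))) :=
      le_min (h _ hij (Nat.le_succ _)) (h _ (hij.trans (Nat.le_succ _)) le_rfl)
    rw [chainCost_succ]
    have h3 := mul_le_mul_of_nonneg_left (dist_triangle (p i) (p j) (p (j + 1))) hm
    have h4 := mul_le_mul_of_nonneg_right h2 (dist_nonneg (x := p j) (y := p (j + 1)))
    linarith

lemma chainCosts_bddBelow (hφ : ∀ y, 0 ≤ φ y) (y : X) :
    BddBelow (insert 1 (chainCosts φ ρ Ω y)) := by
  refine ⟨0, ?_⟩
  rintro c (rfl | ⟨n, p, -, -, -, rfl⟩)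
  exacts [zero_le_one, chainCost_nonneg hφ p n]

lemma chainInf_nonneg (hφ : ∀ y, 0 ≤ φ y) (y : X) : 0 ≤ chainInf φ ρ Ω y := by
  refine le_csInf (insert_nonempty _ _) ?_
  rintro c (rfl | ⟨n, p, -, -, -, rfl⟩)
  exacts [zero_le_one, chainCost_nonneg hφ p n]

lemma chainInf_le_one (hφ : ∀ y, 0 ≤ φ y) (y : X) : chainInf φ ρ Ω y ≤ 1 :=
  csInf_le (chainCosts_bddBelow hφ y) (mem_insert _ _)

lemma chainInf_eq_zero (hφ : ∀ y, 0 ≤ φ y) {y : X} (hy : y ∉ Ω) : chainInf φ ρ Ω y = 0 := by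
  refine le_antisymm (csInf_le (chainCosts_bddBelow hφ y) (mem_insert_of_mem _ ?_))
    (chainInf_nonneg hφ y)
  exact ⟨0, fun _ => y, rfl, hy, by simp, by simp [chainCost]⟩

lemma exists_chain_of_chainInf_lt {y : X} {c : ℝ} (hc : c ≤ 1) (h : chainInf φ ρ Ω y < c) :
    ∃ (n : ℕ) (p : ℕ → X), p 0 = y ∧ p n ∉ Ω ∧ (∀ i < n, dist (p i) (p (i + 1)) < ρ) ∧
      chainCost φ p n ≤ c := by
  obtain ⟨b, (rfl | ⟨n, p, h0, hn, hs, rfl⟩), hb⟩ := exists_lt_of_csInf_lt (insert_nonempty _ _) h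
  · exact absurd hb (not_lt.2 hc)
  · exact ⟨n, p, h0, hn, hs, hb.le⟩

lemma chainInf_le_add (hφ : ∀ y, 0 ≤ φ y) {y z : X} (hyz : dist y z < ρ) :
    chainInf φ ρ Ω y ≤ chainInf φ ρ Ω z + min (φ y) (φ z) * dist y z := by
  have h0 : 0 ≤ min (φ y) (φ z) * dist y z := mul_nonneg (le_min (hφ _) (hφ _)) dist_nonneg
  rw [← sub_le_iff_le_add]
  refine le_csInf (insert_nonempty _ _) ?_
  rintro c (rfl | ⟨n, p, hp0, hn, hs, rfl⟩)
  · linarith [chainInf_le_one (ρ := ρ) (Ω := Ω) hφ y]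
  · rw [sub_le_iff_le_add]
    refine csInf_le (chainCosts_bddBelow hφ y) (mem_insert_of_mem _ ?_)
    refine ⟨n + 1, fun i => Nat.casesOn i y p, rfl, hn, ?_, ?_⟩
    · rintro (_ | i) hi
      · simpa [hp0] using hyz
      · exact hs i (by omega)
    · simp only [chainCost, Finset.sum_range_succ', hp0]
      rfl

lemma abs_chainInf_sub_le (hφ : ∀ y, 0 ≤ φ y) {y z : X} (hyz : dist y z < ρ) :
    |chainInf φ ρ Ω y - chainInf φ ρ Ω z| ≤ φ y * dist y z := by
  have h1 := chainInf_le_add (Ω := Ω) hφ hyz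
  have h2 := chainInf_le_add (Ω := Ω) hφ (by rwa [dist_comm] : dist z y < ρ)
  rw [dist_comm z y] at h2
  have h3 : min (φ y) (φ z) * dist y z ≤ φ y * dist y z :=
    mul_le_mul_of_nonneg_right (min_le_left _ _) dist_nonneg
  have h4 : min (φ z) (φ y) * dist y z ≤ φ y * dist y z :=
    mul_le_mul_of_nonneg_right (min_le_right _ _) dist_nonneg
  rw [abs_le]
  constructor <;> linarith

lemma continuous_chainInf (hφ : ∀ y, 0 ≤ φ y) {M : ℝ} (hM : ∀ y, φ y ≤ M) (hρ : 0 < ρ) :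
    Continuous (chainInf φ ρ Ω) := by
  rw [continuous_iff_continuousAt]
  intro z
  rw [ContinuousAt, tendsto_iff_dist_tendsto_zero]
  have h1 : Tendsto (fun y => M * dist y z) (𝓝 z) (𝓝 0) := by
    have : Tendsto (fun y => M * dist y z) (𝓝 z) (𝓝 (M * dist z z)) :=
      (continuous_const.mul (continuous_id.dist continuous_const)).tendsto z
    simpa using this
  refine squeeze_zero' (Eventually.of_forall fun _ => dist_nonneg) ?_ h1
  filter_upwards [ball_mem_nhds z hρ] with y hy
  rw [Real.dist_eq]
  exact (abs_chainInf_sub_le hφ hy).trans (mul_le_mul_of_nonneg_right (hM y) dist_nonneg)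

/-- A chain of total cost at most `c` can be parametrized on `[0,1]` proportionally to cost. -/
lemma exists_chain_param {p : ℕ → X} {n : ℕ} {c σ δ : ℝ} (hδ : 0 < δ)
    (hφ : ∀ y, δ ≤ φ y) (hσ : 0 ≤ σ)
    (hstep : ∀ i < n, chainCost φ p (i + 1) ≤ chainCost φ p i + σ)
    (hcost : chainCost φ p n ≤ c) :
    ∃ i : ℝ → ℕ, p (i 0) = p 0 ∧ i 1 = n ∧ ∀ s t, 0 ≤ s → s ≤ t → i s ≤ i t ∧
      chainCost φ p (i t) - chainCost φ p (i s) ≤ c * (t - s) + σ := by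
  have hφ0 : ∀ y, 0 ≤ φ y := fun y => hδ.le.trans (hφ y)
  have hc : 0 ≤ c := (chainCost_nonneg hφ0 p n).trans hcost
  have hz : chainCost φ p 0 = 0 := by simp [chainCost]
  classical
  let i : ℝ → ℕ := fun t => Nat.findGreatest (fun j => chainCost φ p j ≤ c * t) n
  have hi : ∀ t, 0 ≤ t → chainCost φ p (i t) ≤ c * t := fun t ht =>
    Nat.findGreatest_spec (P := fun j => chainCost φ p j ≤ c * t) (Nat.zero_le n)
      (by rw [hz]; positivity)
  have hin : ∀ t, i t ≤ n := fun t => Nat.findGreatest_le n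
  refine ⟨i, ?_, ?_, ?_⟩
  · have h1 := mul_dist_le_chainCost_sub (φ := φ) (p := p) hδ.le (Nat.zero_le (i 0))
      fun l _ _ => hφ _
    have h2 := hi 0 le_rfl
    rw [hz] at h1
    have h3 : δ * dist (p 0) (p (i 0)) ≤ 0 := by linarith
    have h4 : dist (p 0) (p (i 0)) ≤ 0 := by
      by_contra! h
      exact absurd h3 (not_le.2 (mul_pos hδ h))
    exact (dist_le_zero.1 h4).symm
  · exact le_antisymm (hin 1) (Nat.le_findGreatest le_rfl (by simpa using hcost))
  · intro s t hs hst
    have hmono : i s ≤ i t := Nat.findGreatest_mono_left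
      (fun j (hj : chainCost φ p j ≤ c * s) => hj.trans (by gcongr)) n
    refine ⟨hmono, ?_⟩
    rcases (hin s).eq_or_lt with h | h
    · have : i t = i s := le_antisymm (h ▸ hin t) hmono
      rw [this, sub_self]
      have := mul_nonneg hc (sub_nonneg.2 hst)
      linarith
    · have h1 : ¬ chainCost φ p (i s + 1) ≤ c * s :=
        Nat.findGreatest_is_greatest (Nat.lt_succ_self _) h
      have h2 := hstep _ h
      have h3 := hi t (hs.trans hst)
      push Not at h1
      linarith

end Chain

/-- The truncation of `h` at level `k + 1`, as a real-valued function. -/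
def truncReal {Y : Type*} (h : Y → ℝ≥0∞) (k : ℕ) (y : Y) : ℝ := (min (h y) (k + 1 : ℕ)).toReal

/-- The mesh size at level `k`. -/
def mesh (k : ℕ) : ℝ := 1 / ((k : ℝ) + 1) ^ 2

lemma mesh_pos (k : ℕ) : 0 < mesh k := by
  unfold mesh
  positivity

lemma truncReal_nonneg {Y : Type*} (h : Y → ℝ≥0∞) (k : ℕ) (y : Y) : 0 ≤ truncReal h k y :=
  ENNReal.toReal_nonneg

lemma truncReal_le {Y : Type*} (h : Y → ℝ≥0∞) (k : ℕ) (y : Y) : truncReal h k y ≤ k + 1 := by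
  refine (ENNReal.toReal_mono (ENNReal.natCast_ne_top (k + 1)) (min_le_right _ _)).trans_eq ?_
  rw [ENNReal.toReal_natCast, Nat.cast_add_one]

lemma ofReal_truncReal_le {Y : Type*} (h : Y → ℝ≥0∞) (k : ℕ) (y : Y) :
    ENNReal.ofReal (truncReal h k y) ≤ h y := by
  rw [truncReal, ENNReal.ofReal_toReal]
  · exact min_le_left _ _
  · exact ne_top_of_le_ne_top (ENNReal.natCast_ne_top _) (min_le_right _ _)

lemma le_truncReal {Y : Type*} {h : Y → ℝ≥0∞} {k : ℕ} {y : Y} {m : ℝ}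
    (hm : ENNReal.ofReal m ≤ h y) (hk : m ≤ k + 1) : m ≤ truncReal h k y := by
  rw [truncReal]
  refine (ENNReal.ofReal_le_iff_le_toReal ?_).1 (le_min hm ?_)
  · exact ne_top_of_le_ne_top (ENNReal.natCast_ne_top _) (min_le_right _ _)
  · rw [← ENNReal.ofReal_natCast]
    exact ENNReal.ofReal_le_ofReal (by push_cast; exact hk)

omit [MeasurableSpace X] in
/-- Discrete chains of bounded cost with mesh tending to zero produce, in the limit, a curve
whose speed is controlled by the density. -/
lemma exists_curve_of_chains [ProperSpace X] {h : X → ℝ≥0∞} (hlsc : LowerSemicontinuous h)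
    {δ : ℝ} (hδ : 0 < δ) (hδ1 : δ ≤ 1) (hδh : ∀ y, ENNReal.ofReal δ ≤ h y)
    {Ω : Set X} (hΩ : IsOpen Ω) {y : X} {c : ℝ} (hc : 0 ≤ c)
    (hch : ∀ k : ℕ, ∃ (n : ℕ) (p : ℕ → X), p 0 = y ∧ p n ∉ Ω ∧
      (∀ i < n, dist (p i) (p (i + 1)) < mesh k) ∧ chainCost (truncReal h k) p n ≤ c) :
    ∃ γ : Curve X, γ.toFun 0 = y ∧ γ.toFun 1 ∉ Ω ∧
      ∀ t ∈ Ioo (0 : ℝ) 1, h (γ.toFun t) * speed γ.toFun t ≤ ENNReal.ofReal c := by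
  choose n p hp0 hpn hstep hcost using hch
  let σ : ℕ → ℝ := fun k => 1 / ((k : ℝ) + 1)
  have hσ0 : ∀ k, 0 ≤ σ k := fun k => by positivity
  have hσ : Tendsto σ atTop (𝓝 0) := tendsto_one_div_add_atTop_nhds_zero_nat
  let C : ℕ → ℕ → ℝ := fun k => chainCost (truncReal h k) (p k)
  have hφδ : ∀ k y, δ ≤ truncReal h k y := fun k y =>
    le_truncReal (hδh y) (hδ1.trans (by linarith [(Nat.cast_nonneg k : (0 : ℝ) ≤ k)]))
  have hpar : ∀ k, ∃ i : ℝ → ℕ, p k (i 0) = p k 0 ∧ i 1 = n k ∧ ∀ s t, 0 ≤ s → s ≤ t →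
      i s ≤ i t ∧ C k (i t) - C k (i s) ≤ c * (t - s) + σ k := by
    intro k
    refine exists_chain_param hδ (hφδ k) (hσ0 k) (fun j hj => ?_) (hcost k)
    rw [chainCost_succ]
    have h1 : min (truncReal h k (p k j)) (truncReal h k (p k (j + 1))) ≤ k + 1 :=
      (min_le_left _ _).trans (truncReal_le _ _ _)
    have h2 : min (truncReal h k (p k j)) (truncReal h k (p k (j + 1))) *
        dist (p k j) (p k (j + 1)) ≤ (k + 1) * mesh k := by
      gcongr
      exact (hstep k j hj).le
    have h3 : ((k : ℝ) + 1) * mesh k = σ k := by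
      simp only [mesh, σ]
      field_simp
    linarith
  choose i hi0 hi1 hiC using hpar
  let Γ : ℕ → ℝ → X := fun k t => p k (i k t)
  have hdistl : ∀ k s t, 0 ≤ s → s ≤ t → ∀ l, i k s ≤ l → l ≤ i k t →
      dist (Γ k s) (p k l) ≤ (c * (t - s) + σ k) / δ := by
    intro k s t hs hst l hl1 hl2
    rw [le_div_iff₀ hδ, mul_comm]
    refine (mul_dist_le_chainCost_sub hδ.le hl1 fun l _ _ => hφδ k _).trans
      (le_trans ?_ (hiC k s t hs hst).2)
    exact sub_le_sub_right (chainCost_mono (truncReal_nonneg h k) _ hl2) _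
  have hdist : ∀ k s t, 0 ≤ s → s ≤ t → dist (Γ k s) (Γ k t) ≤ (c * (t - s) + σ k) / δ :=
    fun k s t hs hst => hdistl k s t hs hst _ (hiC k s t hs hst).1 le_rfl
  let U : Ultrafilter ℕ := hyperfilter ℕ
  have hU : (U : Filter ℕ) ≤ atTop := Nat.hyperfilter_le_atTop
  have hσU : Tendsto σ U (𝓝 0) := hσ.mono_left hU
  have hΓ0 : ∀ k, Γ k 0 = y := fun k => by simp only [Γ, hi0, hp0]
  have hlim : ∀ t, ∃ z, 0 ≤ t → Tendsto (fun k => Γ k t) U (𝓝 z) := by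
    intro t
    by_cases ht : 0 ≤ t
    · have hmem : ∀ k, Γ k t ∈ closedBall y ((c * t + 1) / δ) := fun k => by
        rw [mem_closedBall, dist_comm, ← hΓ0 k]
        refine (hdist k 0 t le_rfl ht).trans ?_
        have : σ k ≤ 1 := by
          simp only [σ]
          rw [div_le_one (by positivity)]
          linarith [(Nat.cast_nonneg k : (0 : ℝ) ≤ k)]
        rw [sub_zero]
        gcongr
      obtain ⟨z, -, hz⟩ := (isCompact_closedBall y ((c * t + 1) / δ)).ultrafilter_le_nhds'
        (U.map fun k => Γ k t) (Ultrafilter.mem_map.2 (univ_mem' hmem))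
      exact ⟨z, fun _ => hz⟩
    · exact ⟨y, fun h => absurd h ht⟩
  choose γ hγ using hlim
  have hbd : ∀ s t, 0 ≤ s → s ≤ t → dist (γ s) (γ t) ≤ c / δ * (t - s) := by
    intro s t hs hst
    have h1 : Tendsto (fun k => (c * (t - s) + σ k) / δ) U (𝓝 ((c * (t - s) + 0) / δ)) :=
      (tendsto_const_nhds.add hσU).div_const _
    refine (le_of_tendsto_of_tendsto ((hγ s hs).dist (hγ t (hs.trans hst))) h1
      (Eventually.of_forall fun k => hdist k s t hs hst)).trans_eq ?_
    ring
  have hcδ : 0 ≤ c / δ := by positivity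
  refine ⟨⟨γ, Real.toNNReal (c / δ), LipschitzOnWith.of_dist_le_mul fun s hs t ht => ?_⟩,
    ?_, ?_, ?_⟩
  · rw [Real.coe_toNNReal _ hcδ, Real.dist_eq]
    rcases le_total s t with hst | hst
    · rw [abs_sub_comm, abs_of_nonneg (sub_nonneg.2 hst)]
      exact hbd s t hs.1 hst
    · rw [dist_comm, abs_of_nonneg (sub_nonneg.2 hst)]
      exact hbd t s ht.1 hst
  · refine tendsto_nhds_unique (hγ 0 le_rfl) ?_
    simp only [hΓ0]
    exact tendsto_const_nhds
  · refine hΩ.isClosed_compl.mem_of_tendsto (hγ 1 zero_le_one) (Eventually.of_forall fun k => ?_)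
    simp only [Γ, hi1]
    exact hpn k
  · intro t ht
    refine ENNReal.mul_le_of_forall_lt fun m hm b hb => ?_
    refine (mul_le_mul_right hb.le m).trans ?_
    have hmtop : m ≠ ⊤ := hm.ne_top
    obtain ⟨r, hr, hball⟩ := Metric.eventually_nhds_iff_ball.1 (hlsc (γ t) m hm)
    obtain ⟨τ, hτ, hτr⟩ : ∃ τ > 0, c / δ * (2 * τ) < r / 4 := by
      refine ⟨r / (8 * (c / δ + 1)) / 2, by positivity, ?_⟩
      have : c / δ * (2 * (r / (8 * (c / δ + 1)) / 2)) = (c / δ) / (c / δ + 1) * (r / 8) := by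
        field_simp
      rw [this]
      have : (c / δ) / (c / δ + 1) ≤ 1 := by
        rw [div_le_one (by positivity)]
        linarith
      nlinarith
    have hkey : ∀ s₁ s₂, 0 ≤ s₁ → s₁ ≤ s₂ → |s₁ - t| < τ → |s₂ - t| < τ →
        m.toReal * dist (γ s₁) (γ s₂) ≤ c * (s₂ - s₁) := by
      intro s₁ s₂ h0 h12 h1 h2
      have hs1 := hγ s₁ h0
      have hs2 := hγ s₂ (h0.trans h12)
      have hlim : Tendsto (fun k => c * (s₂ - s₁) + σ k) U (𝓝 (c * (s₂ - s₁) + 0)) :=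
        tendsto_const_nhds.add hσU
      rw [add_zero] at hlim
      refine le_of_tendsto_of_tendsto ((hs1.dist hs2).const_mul m.toReal) hlim ?_
      have he1 : ∀ᶠ k in (U : Filter ℕ), dist (Γ k s₁) (γ s₁) < r / 4 :=
        hs1.eventually (ball_mem_nhds _ (by positivity))
      have he2 : ∀ᶠ k in (U : Filter ℕ), σ k < δ * (r / 4) :=
        hσU.eventually (gt_mem_nhds (by positivity))
      have he3 : ∀ᶠ k : ℕ in (U : Filter ℕ), m.toReal ≤ (k : ℝ) :=
        (tendsto_natCast_atTop_atTop (R := ℝ)).mono_left hU (eventually_ge_atTop _)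
      filter_upwards [he1, he2, he3] with k hk1 hk2 hk3
      refine (mul_dist_le_chainCost_sub ENNReal.toReal_nonneg (hiC k s₁ s₂ h0 h12).1
        fun l hl1 hl2 => ?_).trans (hiC k s₁ s₂ h0 h12).2
      refine le_truncReal ?_ (by linarith)
      rw [ENNReal.ofReal_toReal hmtop]
      refine (hball _ ?_).le
      have hd1 := hdistl k s₁ s₂ h0 h12 l hl1 hl2
      have hd2 : dist (γ s₁) (γ t) ≤ c / δ * τ := by
        rcases le_total s₁ t with hst | hst
        · refine (hbd s₁ t h0 hst).trans ?_
          gcongr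
          linarith [(abs_lt.1 h1).1]
        · rw [dist_comm]
          refine (hbd t s₁ ht.1.le hst).trans ?_
          gcongr
          linarith [(abs_lt.1 h1).2]
      have hd3 : (c * (s₂ - s₁) + σ k) / δ < c / δ * (2 * τ) + r / 4 := by
        have e1 : (c * (s₂ - s₁) + σ k) / δ = c / δ * (s₂ - s₁) + σ k / δ := by ring
        have e2 : c / δ * (s₂ - s₁) ≤ c / δ * (2 * τ) := by
          gcongr
          linarith [(abs_lt.1 h1).1, (abs_lt.1 h2).2]
        have e3 : σ k / δ < r / 4 := by
          rw [div_lt_iff₀ hδ]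
          linarith
        linarith
      have hd4 : c / δ * τ ≤ c / δ * (2 * τ) := by
        gcongr
        linarith
      rw [mem_ball]
      have t1 := dist_triangle (p k l) (Γ k s₁) (γ t)
      have t2 := dist_triangle (Γ k s₁) (γ s₁) (γ t)
      rw [dist_comm (p k l) (Γ k s₁)] at t1
      linarith
    rw [speed, ← ENNReal.limsup_const_mul_of_ne_top hmtop]
    refine (limsup_le_limsup (v := fun _ : ℝ => ENNReal.ofReal c) ?_).trans ?_
    · have hnb : ∀ᶠ u : ℝ in 𝓝[≠] 0, u ≠ 0 ∧ |u| < min τ t := by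
        refine (eventually_mem_nhdsWithin).and (nhdsWithin_le_nhds ?_)
        filter_upwards [ball_mem_nhds (0 : ℝ) (lt_min hτ ht.1)] with u hu
        simpa using hu
      filter_upwards [hnb] with u hu
      obtain ⟨hu0, hu⟩ := hu
      have hu1 : |u| < τ := hu.trans_le (min_le_left _ _)
      have hu2 : |u| < t := hu.trans_le (min_le_right _ _)
      have hu3 : 0 < |u| := abs_pos.2 hu0
      rw [← ENNReal.ofReal_toReal hmtop, ← ENNReal.ofReal_mul ENNReal.toReal_nonneg]
      refine ENNReal.ofReal_le_ofReal ?_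
      rw [mul_div_assoc', div_le_iff₀ hu3]
      rcases le_total 0 u with h | h
      · have := hkey t (t + u) ht.1.le (by linarith) (by simpa using hτ) (by simpa using hu1)
        rw [dist_comm, abs_of_nonneg h]
        linarith
      · have := hkey (t + u) t (by linarith [neg_abs_le u]) (by linarith) (by simpa using hu1)
          (by simpa using hτ)
        rw [abs_of_nonpos h]
        linarith
    · simp

omit [MeasurableSpace X] in
lemma curveIntegral_mono {g g' : X → ℝ≥0∞} (h : ∀ y, g y ≤ g' y) (γ : Curve X) :
    curveIntegral g γ ≤ curveIntegral g' γ :=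
  lintegral_mono fun _ => mul_le_mul_left (h _) _

lemma IsUpperGradientOn.isWeakUpperGradientOn {g : X → ℝ≥0∞} {u : X → ℝ} {Ω : Set X}
    (h : IsUpperGradientOn g u Ω) (μ : Measure X) : IsWeakUpperGradientOn μ g u Ω := by
  refine ⟨∅, le_antisymm ?_ zero_le, fun γ _ => h γ⟩
  refine (iInf₂_le (fun _ => 0) measurable_const).trans ?_
  exact (iInf_le _ (by simp)).trans (by simp)

omit [MeasurableSpace X] in
lemma IsUpperGradientOn.const_mul {g : X → ℝ≥0∞} {u : X → ℝ} {Ω : Set X}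
    (h : IsUpperGradientOn g u Ω) {s : ℝ} (hs : 0 ≤ s) :
    IsUpperGradientOn (fun y => ENNReal.ofReal s * g y) (fun y => s * u y) Ω := by
  intro γ hγ
  have h1 : curveIntegral (fun y => ENNReal.ofReal s * g y) γ
      = ENNReal.ofReal s * curveIntegral g γ := by
    rw [curveIntegral, curveIntegral, ← lintegral_const_mul' _ _ ENNReal.ofReal_ne_top]
    simp only [mul_assoc]
  rw [h1, ← mul_sub, abs_mul, abs_of_nonneg hs, ENNReal.ofReal_mul hs]
  gcongr
  exact h γ hγ

lemma abs_max_zero_min_one_sub_le (a b : ℝ) :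
    |max 0 (min 1 a) - max 0 (min 1 b)| ≤ |a - b| := by
  grind

/-- The variational capacity is not changed if only genuine upper gradients are admitted. -/
lemma exists_upperGradient_of_vcap1_lt {μ : Measure X} {E Ω : Set X} {a : ℝ≥0∞}
    (h : vcap1 μ E Ω < a) :
    ∃ (u : X → ℝ) (g : X → ℝ≥0∞), (∀ y ∈ E, 1 ≤ u y) ∧ (∀ y ∉ Ω, u y = 0) ∧ Measurable g ∧
      IsUpperGradientOn g u univ ∧ ∫⁻ y, g y ∂μ < a := by
  simp only [vcap1, iInf_lt_iff] at h
  obtain ⟨u, -, huE, huΩ, g, hg, ⟨Γ, hΓ, hug⟩, hga⟩ := h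
  have hΓ' : Mod1 μ Γ < a - ∫⁻ y, g y ∂μ := by
    rw [hΓ]
    exact tsub_pos_of_lt hga
  simp only [Mod1, iInf_lt_iff] at hΓ'
  obtain ⟨ρ, hρ, hρΓ, hρa⟩ := hΓ'
  refine ⟨fun y => max 0 (min 1 (u y)), fun y => g y + ρ y, ?_, ?_, hg.add hρ, ?_, ?_⟩
  · intro y hy
    simp [huE y hy]
  · intro y hy
    simp [huΩ y hy]
  · intro γ hγ
    by_cases hmem : γ ∈ Γ
    · refine le_trans ?_ ((hρΓ γ hmem).trans (curveIntegral_mono (fun _ => le_add_self) γ))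
      rw [← ENNReal.ofReal_one]
      refine ENNReal.ofReal_le_ofReal ?_
      have hb : ∀ y, 0 ≤ max 0 (min 1 (u y)) ∧ max 0 (min 1 (u y)) ≤ 1 := fun y =>
        ⟨le_max_left _ _, max_le zero_le_one (min_le_left _ _)⟩
      rw [abs_le]
      constructor <;> linarith [hb (γ.toFun 0), hb (γ.toFun 1)]
    · refine le_trans (ENNReal.ofReal_le_ofReal ?_)
        ((hug γ hmem hγ).trans (curveIntegral_mono (fun _ => le_self_add) γ))
      exact abs_max_zero_min_one_sub_le _ _
  · rw [lintegral_add_left hg]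
    exact lt_tsub_iff_left.1 hρa

lemma ofReal_abs_iSup_sub_iSup_le {a b : ℕ → ℝ} (ha : BddAbove (range a))
    (hb : BddAbove (range b)) {I : ℝ≥0∞} (h : ∀ k, ENNReal.ofReal |a k - b k| ≤ I) :
    ENNReal.ofReal |(⨆ k, a k) - ⨆ k, b k| ≤ I := by
  by_cases hI : I = ⊤
  · simp [hI]
  have h' : ∀ k, |a k - b k| ≤ I.toReal := fun k => (ENNReal.ofReal_le_iff_le_toReal hI).1 (h k)
  rw [ENNReal.ofReal_le_iff_le_toReal hI, abs_sub_le_iff]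
  constructor
  · rw [sub_le_iff_le_add]
    exact ciSup_le fun k => by linarith [(abs_sub_le_iff.1 (h' k)).1, le_ciSup hb k]
  · rw [sub_le_iff_le_add]
    exact ciSup_le fun k => by linarith [(abs_sub_le_iff.1 (h' k)).2, le_ciSup ha k]

/-- Outer regularity of the variational capacity, with an almost optimal admissible function that
may be multiplied by Lipschitz cutoff functions. -/
lemma exists_isOpen_superset_admissible [ProperSpace X] [BorelSpace X] {μ : Measure X}
    [μ.WeaklyRegular] {E Ω : Set X} (hΩ : IsOpen Ω) (hμΩ : μ Ω ≠ ⊤) {a : ℝ≥0∞}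
    (h : vcap1 μ E Ω < a) :
    ∃ (W : Set X) (w : X → ℝ) (g : X → ℝ≥0∞), IsOpen W ∧ E ⊆ W ∧ Measurable w ∧
      (∀ y, 0 ≤ w y) ∧ (∀ y, w y ≤ 2) ∧ (∀ y ∈ W, 1 ≤ w y) ∧ (∀ y ∉ Ω, w y = 0) ∧
      Measurable g ∧ ∫⁻ y, g y ∂μ < a ∧
      ∀ (η : X → ℝ) (L : ℝ), 0 ≤ L → (∀ y, 0 ≤ η y) → (∀ y, η y ≤ 1) →
        (∀ y z, |η y - η z| ≤ L * dist y z) →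
        IsUpperGradientOn (fun y => g y + ENNReal.ofReal (L * w y)) (fun y => η y * w y) univ := by
  obtain ⟨u, g₀, huE, huΩ, hg₀, hug, hga⟩ := exists_upperGradient_of_vcap1_lt h
  obtain ⟨b, hIb, hba⟩ := exists_between hga
  obtain ⟨s, hs1, hs2, hsb⟩ : ∃ s : ℝ, 1 < s ∧ s ≤ 2 ∧ ENNReal.ofReal s * b < a := by
    have h1 : Tendsto (fun s : ℝ => ENNReal.ofReal s * b) (𝓝[>] 1) (𝓝 (ENNReal.ofReal 1 * b)) :=
      (ENNReal.Tendsto.mul_const (ENNReal.continuous_ofReal.tendsto 1)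
        (Or.inr hba.ne_top)).mono_left nhdsWithin_le_nhds
    rw [ENNReal.ofReal_one, one_mul] at h1
    have h2 : ∀ᶠ s : ℝ in 𝓝[>] 1, s ∈ Ioc (1 : ℝ) 2 := Ioc_mem_nhdsGT one_lt_two
    obtain ⟨s, hs, hs'⟩ := ((h1.eventually (gt_mem_nhds hba)).and h2).exists
    exact ⟨s, hs'.1, hs'.2, hs⟩
  set ε : ℝ≥0∞ := (b - ∫⁻ y, g₀ y ∂μ) / 2 with hε
  have hε0 : ε ≠ 0 := (ENNReal.half_pos (tsub_pos_of_lt hIb).ne').ne'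
  obtain ⟨δ, hδ0, hδ1, hδε⟩ : ∃ δ : ℝ, 0 < δ ∧ δ ≤ 1 ∧ ENNReal.ofReal δ * μ Ω < ε := by
    have h1 : Tendsto (fun s : ℝ => ENNReal.ofReal s * μ Ω) (𝓝[>] 0)
        (𝓝 (ENNReal.ofReal 0 * μ Ω)) :=
      (ENNReal.Tendsto.mul_const (ENNReal.continuous_ofReal.tendsto 0)
        (Or.inr hμΩ)).mono_left nhdsWithin_le_nhds
    rw [ENNReal.ofReal_zero, zero_mul] at h1
    have h2 : ∀ᶠ s : ℝ in 𝓝[>] 0, s ∈ Ioc (0 : ℝ) 1 := Ioc_mem_nhdsGT one_pos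
    obtain ⟨s, hs, hs'⟩ := ((h1.eventually (gt_mem_nhds (pos_iff_ne_zero.2 hε0))).and h2).exists
    exact ⟨s, hs'.1, hs'.2, hs⟩
  obtain ⟨h₀, hgh, hlsc₀, hh₀⟩ := exists_le_lowerSemicontinuous_lintegral_ge μ g₀ hg₀ hε0
  set H : X → ℝ≥0∞ := fun y => h₀ y + ENNReal.ofReal δ with hH
  have hlsc : LowerSemicontinuous H := hlsc₀.add lowerSemicontinuous_const
  have hHδ : ∀ y, ENNReal.ofReal δ ≤ H y := fun y => le_add_self
  have hgH : ∀ y, g₀ y ≤ H y := fun y => (hgh y).trans le_self_add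
  let wk : ℕ → X → ℝ := fun k => chainInf (truncReal H k) (mesh k) Ω
  have hwk0 : ∀ k y, 0 ≤ wk k y := fun k y => chainInf_nonneg (truncReal_nonneg H k) y
  have hwk1 : ∀ k y, wk k y ≤ 1 := fun k y => chainInf_le_one (truncReal_nonneg H k) y
  have hwkΩ : ∀ k, ∀ y ∉ Ω, wk k y = 0 := fun k y hy =>
    chainInf_eq_zero (truncReal_nonneg H k) hy
  have hwkc : ∀ k, Continuous (wk k) := fun k =>
    continuous_chainInf (truncReal_nonneg H k) (truncReal_le H k) (mesh_pos k)
  have hbdd : ∀ y, BddAbove (range fun k => wk k y) := fun y =>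
    ⟨1, by rintro _ ⟨k, rfl⟩; exact hwk1 k y⟩
  let w₁ : X → ℝ := fun y => ⨆ k, wk k y
  have hs0 : 0 < s := one_pos.trans hs1
  have hw₁0 : ∀ y, 0 ≤ w₁ y := fun y => Real.iSup_nonneg fun k => hwk0 k y
  have hw₁1 : ∀ y, w₁ y ≤ 1 := fun y => ciSup_le fun k => hwk1 k y
  refine ⟨⋃ k, {y | 1 / s < wk k y}, fun y => s * w₁ y,
    fun y => ENNReal.ofReal s * Ω.indicator H y, ?_, ?_, ?_, ?_, ?_, ?_, ?_, ?_, ?_, ?_⟩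
  · exact isOpen_iUnion fun k => isOpen_lt continuous_const (hwkc k)
  · intro y hy
    by_contra hcon
    simp only [mem_iUnion, mem_ofPred_eq, not_exists, not_lt] at hcon
    have hs' : 1 / s < 1 := by rw [div_lt_one hs0]; exact hs1
    set c : ℝ := (1 / s + 1) / 2 with hc
    have hc0 : 0 ≤ c := by positivity
    have hc1 : c < 1 := by linarith
    obtain ⟨γ, hγ0, hγ1, hγ⟩ := exists_curve_of_chains hlsc hδ0 hδ1 hHδ hΩ (y := y) hc0
      fun k => exists_chain_of_chainInf_lt hc1.le ((hcon k).trans_lt (by linarith))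
    have h1 : (1 : ℝ≥0∞) ≤ curveIntegral g₀ γ := by
      refine le_trans ?_ (hug γ fun _ _ => mem_univ _)
      rw [hγ0, huΩ _ hγ1, zero_sub, abs_neg, ← ENNReal.ofReal_one]
      exact ENNReal.ofReal_le_ofReal ((huE y hy).trans (le_abs_self _))
    have h2 : curveIntegral g₀ γ ≤ ENNReal.ofReal c := by
      refine (curveIntegral_mono hgH γ).trans ?_
      rw [curveIntegral, ← restrict_Ioo_eq_restrict_Icc]
      refine (setLIntegral_mono measurable_const hγ).trans ?_
      simp
    have h3 := h1.trans h2
    rw [← ENNReal.ofReal_one, ENNReal.ofReal_le_ofReal_iff hc0] at h3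
    linarith
  · exact (Measurable.iSup fun k => (hwkc k).measurable).const_mul s
  · exact fun y => mul_nonneg hs0.le (hw₁0 y)
  · intro y
    nlinarith [hw₁1 y, hw₁0 y]
  · intro y hy
    obtain ⟨k, hk⟩ := mem_iUnion.1 hy
    have h1 : 1 / s < w₁ y := lt_of_lt_of_le hk (le_ciSup (hbdd y) k)
    rw [div_lt_iff₀ hs0] at h1
    change 1 ≤ s * w₁ y
    linarith
  · intro y hy
    simp [w₁, hwkΩ _ y hy]
  · exact (hlsc.measurable.indicator hΩ.measurableSet).const_mul _
  · rw [lintegral_const_mul' _ _ ENNReal.ofReal_ne_top, lintegral_indicator hΩ.measurableSet]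
    refine lt_of_le_of_lt (mul_le_mul_right ?_ _) hsb
    calc ∫⁻ y in Ω, H y ∂μ = ∫⁻ y in Ω, h₀ y ∂μ + ENNReal.ofReal δ * μ Ω := by
          rw [lintegral_add_right _ measurable_const]
          simp
      _ ≤ (∫⁻ y, g₀ y ∂μ + ε) + ε :=
          add_le_add ((setLIntegral_le_lintegral _ _).trans hh₀) hδε.le
      _ = b := by
          rw [add_assoc, hε, ENNReal.add_halves, add_tsub_cancel_of_le hIb.le]
  · intro η L hL hη0 hη1 hηL
    have hmain : IsUpperGradientOn (fun y => Ω.indicator H y + ENNReal.ofReal (L * w₁ y))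
        (fun y => η y * w₁ y) univ := by
      intro γ hγ
      have hmul : ∀ y, η y * w₁ y = ⨆ k, η y * wk k y := fun y =>
        Real.mul_iSup_of_nonneg (hη0 y) _
      have hbdd' : ∀ y, BddAbove (range fun k => η y * wk k y) := fun y =>
        ⟨1, by rintro _ ⟨k, rfl⟩; exact mul_le_one₀ (hη1 y) (hwk0 k y) (hwk1 k y)⟩
      simp only [hmul]
      refine ofReal_abs_iSup_sub_iSup_le (hbdd' _) (hbdd' _) fun k => ?_
      refine isUpperGradientOn_of_local (v := fun y => η y * wk k y)
        (φ := fun y => truncReal H k y + L * wk k y) (M := k + 1 + L)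
        (fun y => mul_nonneg (hη0 y) (hwk0 k y))
        (fun y => mul_le_one₀ (hη1 y) (hwk0 k y) (hwk1 k y)) (mesh_pos k)
        (fun y => add_nonneg (truncReal_nonneg H k y) (mul_nonneg hL (hwk0 k y)))
        (fun y => add_le_add (truncReal_le H k y) (mul_le_of_le_one_right hL (hwk1 k y)))
        ?_ ?_ γ hγ
      · intro y z hyz
        have h1 : |wk k y - wk k z| ≤ truncReal H k y * dist y z :=
          abs_chainInf_sub_le (truncReal_nonneg H k) hyz
        calc |η y * wk k y - η z * wk k z|
            = |η z * (wk k y - wk k z) + wk k y * (η y - η z)| := by ring_nf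
          _ ≤ |η z * (wk k y - wk k z)| + |wk k y * (η y - η z)| := abs_add_le _ _
          _ = η z * |wk k y - wk k z| + wk k y * |η y - η z| := by
              rw [abs_mul, abs_mul, abs_of_nonneg (hη0 z), abs_of_nonneg (hwk0 k y)]
          _ ≤ 1 * (truncReal H k y * dist y z) + wk k y * (L * dist y z) := by
              gcongr
              · exact hη1 z
              · exact hwk0 k y
              · exact hηL y z
          _ = _ := by ring
      · intro y hy
        have hyΩ : y ∈ Ω := by
          by_contra hyΩ
          exact hy (by simp [hwkΩ k y hyΩ])
        rw [indicator_of_mem hyΩ, ENNReal.ofReal_add (truncReal_nonneg H k y)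
          (mul_nonneg hL (hwk0 k y))]
        refine add_le_add (ofReal_truncReal_le H k y) (ENNReal.ofReal_le_ofReal ?_)
        exact mul_le_mul_of_nonneg_left (le_ciSup (hbdd y) k) hL
    convert hmain.const_mul hs0.le using 2 with y y
    · rw [mul_add, ← ENNReal.ofReal_mul hs0.le]
      ring_nf
    · ring

section Doubling

variable {μ : Measure X} {Cd CP lam : ℝ}

lemma MMS.measure_ball_pos (hX : MMS μ Cd CP lam) (x : X) {r : ℝ} (hr : 0 < r) :
    0 < μ (ball x r) := by
  have := (hX.doubling x (r / 2) (by positivity)).1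
  rwa [mul_div_cancel₀ r two_ne_zero] at this

lemma MMS.measure_ball_lt_top (hX : MMS μ Cd CP lam) (x : X) (r : ℝ) : μ (ball x r) < ⊤ :=
  (measure_mono (ball_subset_ball (le_max_left r 1))).trans_lt
    (hX.doubling x (max r 1) (by positivity)).2.2

lemma MMS.measure_ball_two_pow_mul_le (hX : MMS μ Cd CP lam) (x : X) {r : ℝ} (hr : 0 < r)
    (n : ℕ) : μ (ball x (2 ^ n * r)) ≤ ENNReal.ofReal Cd ^ n * μ (ball x r) := by
  induction n with
  | zero => simp
  | succ n ih =>
    rw [pow_succ', mul_assoc, pow_succ', mul_assoc]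
    exact (hX.doubling x _ (by positivity)).2.1.trans (mul_le_mul_right ih _)

lemma MMS.isLocallyFiniteMeasure (hX : MMS μ Cd CP lam) : IsLocallyFiniteMeasure μ :=
  ⟨fun x => ⟨ball x 1, ball_mem_nhds x one_pos, hX.measure_ball_lt_top x 1⟩⟩

lemma MMS.properSpace [BorelSpace X] (hX : MMS μ Cd CP lam) : ProperSpace X := by
  have := hX.complete
  refine ⟨fun x r => TotallyBounded.isCompact_of_isClosed ?_ isClosed_closedBall⟩
  rw [Metric.totallyBounded_iff]
  intro ε hε
  obtain ⟨u, hut, hdisj, hcov⟩ := Vitali.exists_disjoint_subfamily_covering_enlargement_closedBall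
    (closedBall x r) id (fun _ => ε / 6) (ε / 6) (fun _ _ => le_rfl) 5 (by norm_num)
  refine ⟨u, ?_, fun a ha => ?_⟩
  · obtain ⟨n, hn⟩ := pow_unbounded_of_one_lt ((r + 1) / (ε / 6)) (one_lt_two (α := ℝ))
    rw [div_lt_iff₀ (by positivity)] at hn
    have hc : 0 < μ (ball x 1) / ENNReal.ofReal Cd ^ n :=
      ENNReal.div_pos (hX.measure_ball_pos x one_pos).ne' (ENNReal.pow_ne_top ENNReal.ofReal_ne_top)
    have hfin := Measure.finite_const_le_meas_of_disjoint_iUnion μ hc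
      (As := fun a : u => closedBall (a : X) (ε / 6)) (fun _ => measurableSet_closedBall)
      (fun a b hab => hdisj a.2 b.2 (Subtype.coe_ne_coe.2 hab)) ?_
    · have huniv : {a : u | μ (ball x 1) / ENNReal.ofReal Cd ^ n ≤
          μ (closedBall (a : X) (ε / 6))} = univ := by
        refine eq_univ_of_forall fun a => ?_
        have hax : dist (a : X) x ≤ r := hut a.2
        refine ENNReal.div_le_of_le_mul' ?_
        calc μ (ball x 1) ≤ μ (ball (a : X) (2 ^ n * (ε / 6))) := by
              refine measure_mono (ball_subset_ball' ?_)
              rw [dist_comm]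
              linarith
          _ ≤ ENNReal.ofReal Cd ^ n * μ (ball (a : X) (ε / 6)) :=
              hX.measure_ball_two_pow_mul_le _ (by positivity) n
          _ ≤ _ := mul_le_mul_right (measure_mono ball_subset_closedBall) _
      rw [huniv, Set.finite_univ_iff] at hfin
      exact u.toFinite
    · refine ne_top_of_le_ne_top (hX.measure_ball_lt_top x (r + ε)).ne (measure_mono ?_)
      refine iUnion_subset fun a => ?_
      have hax : dist (a : X) x ≤ r := hut a.2
      exact (closedBall_subset_ball (by linarith : ε / 6 < ε)).trans
        (ball_subset_ball' (by linarith))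
  · obtain ⟨b, hb, hab⟩ := hcov a ha
    refine mem_iUnion₂.2 ⟨b, hb, ?_⟩
    have := hab (mem_closedBall_self (by positivity))
    rw [mem_closedBall] at this
    rw [mem_ball]
    exact this.trans_lt (by linarith)

/-- The Poincaré inequality forces spheres that separate points to be nonempty. -/
lemma MMS.exists_dist_eq [BorelSpace X] (hX : MMS μ Cd CP lam) {x z : X} {r : ℝ} (hr : 0 < r)
    (hrz : r < dist z x) : ∃ y, dist y x = r := by
  by_contra! hne
  let u : X → ℝ := (ball x r).indicator fun _ => 1
  have hu : IsUpperGradientOn (fun _ => 0) u univ := by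
    intro γ _
    obtain ⟨K, hK⟩ := γ.lipschitz
    have hcont : ContinuousOn (fun t => dist (γ.toFun t) x) (Icc 0 1) :=
      (continuous_id.dist continuous_const).comp_continuousOn hK.continuousOn
    have hside : γ.toFun 0 ∈ ball x r ↔ γ.toFun 1 ∈ ball x r := by
      rw [mem_ball, mem_ball]
      constructor
      · intro h0
        by_contra! h1
        obtain ⟨t, -, ht⟩ := intermediate_value_Icc zero_le_one hcont ⟨h0.le, h1⟩
        exact hne _ ht
      · intro h1
        by_contra! h0
        obtain ⟨t, -, ht⟩ := intermediate_value_Icc' zero_le_one hcont ⟨h1.le, h0⟩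
        exact hne _ ht
    have : u (γ.toFun 1) = u (γ.toFun 0) := by
      by_cases h0 : γ.toFun 0 ∈ ball x r
      · simp only [u, indicator_of_mem h0, indicator_of_mem (hside.1 h0)]
      · simp only [u, indicator_of_notMem h0, indicator_of_notMem fun h1 => h0 (hside.2 h1)]
    simp [this]
  have hint : Integrable u μ :=
    (integrable_indicator_iff measurableSet_ball).2
      (integrableOn_const (hX.measure_ball_lt_top x r).ne)
  have hpoin := hX.poincare x (dist z x + 1) (by positivity) u hint.locallyIntegrable
    (fun _ => 0) measurable_const hu
  rw [lintegral_zero, mul_zero, nonpos_iff_eq_zero] at hpoin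
  set m := ⨍ z in ball x (dist z x + 1), u z ∂μ
  have hconst : ∀ (y : X) (s c : ℝ), 0 < s → ball y s ⊆ ball x (dist z x + 1) →
      (∀ q ∈ ball y s, u q = c) → c = m := by
    intro y s c hs hsub hc
    have h1 : ∫⁻ q in ball y s, ENNReal.ofReal |u q - m| ∂μ =
        ENNReal.ofReal |c - m| * μ (ball y s) := by
      rw [← setLIntegral_const]
      exact setLIntegral_congr_fun measurableSet_ball fun q hq => by simp only [hc q hq]
    have h2 : ENNReal.ofReal |c - m| * μ (ball y s) = 0 :=
      le_antisymm (h1 ▸ (lintegral_mono_set hsub).trans hpoin.le) zero_le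
    rcases mul_eq_zero.1 h2 with h | h
    · exact sub_eq_zero.1 (abs_nonpos_iff.1 (ENNReal.ofReal_eq_zero.1 h))
    · exact absurd h (hX.measure_ball_pos y hs).ne'
  have e1 : (1 : ℝ) = m := hconst x r 1 hr (ball_subset_ball (by linarith))
    fun q hq => indicator_of_mem hq _
  have e0 : (0 : ℝ) = m := by
    refine hconst z (min (dist z x - r) 1) 0 (lt_min (by linarith) one_pos)
      (ball_subset_ball' ?_) fun q hq => indicator_of_notMem ?_ _
    · linarith [min_le_right (dist z x - r) 1]
    · rw [mem_ball, not_lt]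
      have h1 : dist q z < dist z x - r := lt_of_lt_of_le hq (min_le_left _ _)
      have h2 := dist_triangle_left z x q
      linarith
  linarith

lemma integrable_of_le_two_of_eq_zero {Y : Type*} [MeasurableSpace Y] {μ : Measure Y}
    {w : Y → ℝ} {S : Set Y} (hS : MeasurableSet S)
    (hμS : μ S ≠ ⊤) (hw : Measurable w) (hw0 : ∀ y, 0 ≤ w y) (hw2 : ∀ y, w y ≤ 2)
    (hwS : ∀ y ∉ S, w y = 0) : Integrable w μ := by
  refine Integrable.mono' (g := S.indicator fun _ => 2)
    ((integrable_indicator_iff hS).2 (integrableOn_const hμS)) hw.aestronglyMeasurable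
    (Eventually.of_forall fun y => ?_)
  rw [Real.norm_of_nonneg (hw0 y)]
  by_cases hy : y ∈ S
  · rw [indicator_of_mem hy]
    exact hw2 y
  · rw [indicator_of_notMem hy, hwS y hy]

/-- A Friedrichs-type inequality for functions supported in a small ball. -/
lemma MMS.lintegral_le_of_support [BorelSpace X] (hX : MMS μ Cd CP lam) {x z : X} {R : ℝ}
    (hR : 0 < R) (hRz : 3 * R < dist z x) {w : X → ℝ} (hw : Measurable w) (hw0 : ∀ y, 0 ≤ w y)
    (hw2 : ∀ y, w y ≤ 2) (hwx : ∀ y ∉ ball x (2 * R), w y = 0) {g : X → ℝ≥0∞}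
    (hg : Measurable g) (hwg : IsUpperGradientOn g w univ) :
    ∫⁻ y, ENNReal.ofReal (w y) ∂μ ≤
      ENNReal.ofReal ((1 + Cd ^ 3) * (CP * (4 * R))) * ∫⁻ y, g y ∂μ := by
  obtain ⟨q, hq⟩ := hX.exists_dist_eq (by positivity) hRz
  have hCd : 0 ≤ Cd := zero_le_one.trans hX.hCd
  have hint := integrable_of_le_two_of_eq_zero measurableSet_ball
    (hX.measure_ball_lt_top x (2 * R)).ne hw hw0 hw2 hwx
  have hpoin := hX.poincare x (4 * R) (by positivity) w hint.locallyIntegrable g hg hwg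
  set m := ⨍ z in ball x (4 * R), w z ∂μ
  set J := ∫⁻ y in ball x (4 * R), ENNReal.ofReal |w y - m| ∂μ
  have hJ : J ≤ ENNReal.ofReal (CP * (4 * R)) * ∫⁻ y, g y ∂μ := by
    refine hpoin.trans ?_
    refine mul_le_mul' (mul_le_of_le_one_right zero_le ?_) (setLIntegral_le_lintegral _ _)
    refine ENNReal.div_le_of_le_mul ?_
    rw [one_mul]
    refine measure_mono (ball_subset_ball ?_)
    nlinarith [hX.hlam]
  have hm : ENNReal.ofReal |m| * μ (ball q R) ≤ J := by
    rw [← setLIntegral_const]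
    refine le_trans (le_of_eq ?_) (lintegral_mono_set (ball_subset_ball' (ε₁ := R) (x := q) ?_))
    · refine setLIntegral_congr_fun measurableSet_ball fun y hy => ?_
      have hy0 : w y = 0 := by
        refine hwx y ?_
        rw [mem_ball, not_lt]
        have h1 : dist y q < R := hy
        have h2 := dist_triangle_left q x y
        linarith
      simp only [hy0, zero_sub, abs_neg]
    · linarith
  have hball : μ (ball x (4 * R)) ≤ ENNReal.ofReal Cd ^ 3 * μ (ball q R) := by
    refine (measure_mono (ball_subset_ball' ?_)).trans (hX.measure_ball_two_pow_mul_le q hR 3)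
    rw [dist_comm]
    linarith
  calc ∫⁻ y, ENNReal.ofReal (w y) ∂μ = ∫⁻ y in ball x (4 * R), ENNReal.ofReal (w y) ∂μ := by
        refine (setLIntegral_eq_of_support_subset ?_).symm
        intro y hy
        by_contra hy4
        refine hy ?_
        simp only [hwx y fun h => hy4 (ball_subset_ball (by linarith) h), ENNReal.ofReal_zero]
    _ ≤ ∫⁻ y in ball x (4 * R), (ENNReal.ofReal |w y - m| + ENNReal.ofReal |m|) ∂μ := by
        refine lintegral_mono fun y => ?_
        rw [← ENNReal.ofReal_add (abs_nonneg _) (abs_nonneg _)]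
        refine ENNReal.ofReal_le_ofReal ?_
        linarith [le_abs_self (w y - m), le_abs_self m]
    _ = J + ENNReal.ofReal |m| * μ (ball x (4 * R)) := by
        rw [lintegral_add_right _ measurable_const, setLIntegral_const]
    _ ≤ J + ENNReal.ofReal |m| * (ENNReal.ofReal Cd ^ 3 * μ (ball q R)) := by gcongr
    _ = J + ENNReal.ofReal Cd ^ 3 * (ENNReal.ofReal |m| * μ (ball q R)) := by ring
    _ ≤ J + ENNReal.ofReal Cd ^ 3 * J := by gcongr
    _ = ENNReal.ofReal (1 + Cd ^ 3) * J := by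
        rw [ENNReal.ofReal_add zero_le_one (by positivity), ENNReal.ofReal_one,
          ENNReal.ofReal_pow hCd]
        ring
    _ ≤ ENNReal.ofReal (1 + Cd ^ 3) *
          (ENNReal.ofReal (CP * (4 * R)) * ∫⁻ y, g y ∂μ) := by gcongr
    _ = _ := by rw [← mul_assoc, ← ENNReal.ofReal_mul (by positivity)]

end Doubling

section Thin

variable {μ : Measure X} {Cd CP lam : ℝ}

/-- A set of small capacity in one ball has an open neighbourhood that has small capacity in all
balls of comparable or larger radius. -/
lemma MMS.exists_isOpen_superset_vcap1_le [BorelSpace X] (hX : MMS μ Cd CP lam) {x z : X} {R : ℝ}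
    (hR : 0 < R) (hRz : 3 * R < dist z x) {E : Set X} {a : ℝ≥0∞}
    (hE : vcap1 μ E (ball x (2 * R)) < a) :
    ∃ W, IsOpen W ∧ E ⊆ W ∧ ∀ r, 0 < r → R ≤ 4 * r → ∀ S, S ∩ ball x r ⊆ W →
      vcap1 μ (S ∩ ball x r) (ball x (2 * r)) ≤
        ENNReal.ofReal (1 + (1 + Cd ^ 3) * CP * 16) * a := by
  have := hX.properSpace
  have := hX.isLocallyFiniteMeasure
  have hCd : 0 ≤ Cd := zero_le_one.trans hX.hCd
  have hCP : 0 < CP := hX.hCP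
  obtain ⟨W, w, g, hW, hEW, hw, hw0, hw2, hwW, hwx, hg, hga, hadm⟩ :=
    exists_isOpen_superset_admissible isOpen_ball (hX.measure_ball_lt_top x (2 * R)).ne hE
  refine ⟨W, hW, hEW, fun r hr hRr S hS => ?_⟩
  have hwg : IsUpperGradientOn g w univ := by
    have := hadm (fun _ => 1) 0 le_rfl (fun _ => zero_le_one) (fun _ => le_rfl) (by simp)
    simpa using this
  have hfried := hX.lintegral_le_of_support hR hRz hw hw0 hw2 hwx hg hwg
  let η : X → ℝ := fun y => max 0 (min 1 (2 - dist y x / r))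
  have hη0 : ∀ y, 0 ≤ η y := fun y => le_max_left _ _
  have hη1 : ∀ y, η y ≤ 1 := fun y => max_le zero_le_one (min_le_left _ _)
  have hηm : Measurable η := by
    have : Continuous η := by fun_prop
    exact this.measurable
  have hηL : ∀ y z, |η y - η z| ≤ 1 / r * dist y z := by
    intro y z
    refine (abs_max_zero_min_one_sub_le _ _).trans ?_
    have : 2 - dist y x / r - (2 - dist z x / r) = 1 / r * (dist z x - dist y x) := by ring
    rw [this, abs_mul, abs_of_pos (by positivity : 0 < 1 / r), dist_comm y z]
    gcongr
    exact abs_dist_sub_le z y x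
  have hηx : ∀ y ∉ ball x (2 * r), η y = 0 := by
    intro y hy
    rw [mem_ball, not_lt] at hy
    refine max_eq_left ((min_le_right _ _).trans ?_)
    rw [sub_nonpos, le_div_iff₀ hr]
    exact hy
  have hηone : ∀ y ∈ ball x r, η y = 1 := by
    intro y hy
    have : dist y x / r ≤ 1 := (div_le_one hr).2 (le_of_lt hy)
    simp only [η]
    rw [min_eq_left (by linarith), max_eq_right zero_le_one]
  have hgrad := hadm η (1 / r) (by positivity) hη0 hη1 hηL
  have hgm : Measurable fun y => g y + ENNReal.ofReal (1 / r * w y) :=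
    hg.add (hw.const_mul _).ennreal_ofReal
  have hgint : ∫⁻ y, (g y + ENNReal.ofReal (1 / r * w y)) ∂μ ≤
      ENNReal.ofReal (1 + (1 + Cd ^ 3) * CP * 16) * ∫⁻ y, g y ∂μ := by
    have hsplit : ∫⁻ y, ENNReal.ofReal (1 / r * w y) ∂μ =
        ENNReal.ofReal (1 / r) * ∫⁻ y, ENNReal.ofReal (w y) ∂μ := by
      rw [← lintegral_const_mul _ hw.ennreal_ofReal]
      exact lintegral_congr fun y => ENNReal.ofReal_mul (by positivity)
    have hconst : 1 / r * ((1 + Cd ^ 3) * (CP * (4 * R))) ≤ (1 + Cd ^ 3) * CP * 16 := by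
      rw [one_div, inv_mul_le_iff₀ hr]
      have : 0 ≤ (1 + Cd ^ 3) * CP := by positivity
      nlinarith
    calc ∫⁻ y, (g y + ENNReal.ofReal (1 / r * w y)) ∂μ
        = ∫⁻ y, g y ∂μ + ENNReal.ofReal (1 / r) * ∫⁻ y, ENNReal.ofReal (w y) ∂μ := by
          rw [lintegral_add_left hg, hsplit]
      _ ≤ ∫⁻ y, g y ∂μ + ENNReal.ofReal (1 / r) *
            (ENNReal.ofReal ((1 + Cd ^ 3) * (CP * (4 * R))) * ∫⁻ y, g y ∂μ) := by gcongr
      _ = ∫⁻ y, g y ∂μ +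
            ENNReal.ofReal (1 / r * ((1 + Cd ^ 3) * (CP * (4 * R)))) * ∫⁻ y, g y ∂μ := by
          rw [← mul_assoc, ← ENNReal.ofReal_mul (by positivity)]
      _ ≤ ∫⁻ y, g y ∂μ + ENNReal.ofReal ((1 + Cd ^ 3) * CP * 16) * ∫⁻ y, g y ∂μ := by gcongr
      _ = _ := by
          rw [ENNReal.ofReal_add zero_le_one (by positivity), ENNReal.ofReal_one]
          ring
  have hgtop : ∫⁻ y, (g y + ENNReal.ofReal (1 / r * w y)) ∂μ < ⊤ :=
    hgint.trans_lt (ENNReal.mul_lt_top ENNReal.ofReal_lt_top (hga.trans_le le_top))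
  have hmem : MemN11 μ fun y => η y * w y := by
    refine ⟨?_, _, hgm, hgrad.isWeakUpperGradientOn μ, hgtop⟩
    refine integrable_of_le_two_of_eq_zero measurableSet_ball
      (hX.measure_ball_lt_top x (2 * R)).ne (hηm.mul hw) (fun y => mul_nonneg (hη0 y) (hw0 y))
      (fun y => (mul_le_of_le_one_left (hw0 y) (hη1 y)).trans (hw2 y)) fun y hy => ?_
    rw [hwx y hy, mul_zero]
  refine le_trans ?_ (hgint.trans (mul_le_mul_right hga.le _))
  refine iInf_le_of_le _ (iInf_le_of_le hmem (iInf_le_of_le (fun y hy => ?_)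
    (iInf_le_of_le (fun y hy => ?_) (iInf_le_of_le _ (iInf_le_of_le hgm
      (iInf_le_of_le (hgrad.isWeakUpperGradientOn μ) le_rfl))))))
  · rw [hηone y hy.2, one_mul]
    exact hwW y (hS hy)
  · rw [hηx y hy, zero_mul]

/-- Gluing of neighbourhoods at dyadic scales around `x`. -/
lemma exists_isOpen_superset_inter_ball_subset {Y : Type*} [MetricSpace Y] {A : Set Y} {x : Y}
    (hxA : x ∉ A) {V : ℕ → Set Y} (hV : ∀ j, IsOpen (V j))
    (hAV : ∀ j, A ∩ ball x ((1 / 2) ^ j) ⊆ V j) :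
    ∃ W, IsOpen W ∧ A ⊆ W ∧ ∀ j, W ∩ ball x ((1 / 2) ^ (j + 1)) ⊆ V j := by
  have hanti : StrictAnti fun j : ℕ => (1 / 2 : ℝ) ^ j :=
    pow_right_strictAnti₀ (by norm_num) (by norm_num)
  have hfar : ∀ c : ℝ, IsOpen {y | c < dist y x} := fun c =>
    isOpen_lt continuous_const (continuous_id.dist continuous_const)
  refine ⟨⋃ i : ℕ, {y | (1 / 2 : ℝ) ^ i < dist y x} ∩
    ⋂ j ∈ Finset.range i, (V j ∪ {y | (1 / 2 : ℝ) ^ (j + 1) < dist y x}), ?_, ?_, ?_⟩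
  · exact isOpen_iUnion fun i => (hfar _).inter
      (isOpen_biInter_finset fun j _ => (hV j).union (hfar _))
  · intro y hy
    have hyx : 0 < dist y x := dist_pos.2 fun h => hxA (h ▸ hy)
    obtain ⟨i, hi⟩ := exists_pow_lt_of_lt_one hyx (by norm_num : (1 / 2 : ℝ) < 1)
    refine mem_iUnion.2 ⟨i, hi, mem_iInter₂.2 fun j _ => ?_⟩
    rcases lt_or_ge ((1 / 2 : ℝ) ^ (j + 1)) (dist y x) with h | h
    · exact Or.inr h
    · exact Or.inl (hAV j ⟨hy, h.trans_lt (hanti (Nat.lt_succ_self j))⟩)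
  · rintro j y ⟨hyW, hyx⟩
    obtain ⟨i, hi, hyi⟩ := mem_iUnion.1 hyW
    have hij : j + 1 < i := hanti.lt_iff_gt.1 (lt_trans hi hyx)
    rcases mem_iInter₂.1 hyi j (Finset.mem_range.2 (by omega)) with h | h
    · exact h
    · exact absurd h (lt_asymm (mem_ball.1 hyx))

end Thin

/-- **Open modification of thin sets.** If `A` is 1-thin at `x ∉ A`, then there exists an open
set `W ⊇ A` that is 1-thin at `x`. -/
theorem open_modification_of_thin_sets
    {X : Type*} [MetricSpace X] [MeasurableSpace X] [BorelSpace X]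
    (μ : Measure X) (Cd CP lam : ℝ) (hX : MMS μ Cd CP lam)
    (A : Set X) (x : X) (hxA : x ∉ A) (hthin : IsThinAt μ A x) :
    ∃ W : Set X, IsOpen W ∧ A ⊆ W ∧ IsThinAt μ W x := by
  have := hX.nontrivial
  obtain ⟨z, hz⟩ := exists_ne x
  set R : ℕ → ℝ := fun j => (1 / 2) ^ j with hRdef
  have hRpos : ∀ j, 0 < R j := fun j => by positivity
  have hR0 : Tendsto R atTop (𝓝 0) :=
    tendsto_pow_atTop_nhds_zero_of_lt_one (by norm_num) (by norm_num)
  have hRanti : Antitone R := pow_right_anti₀ (by norm_num) (by norm_num)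
  let c : ℕ → ℝ≥0∞ := fun j => vcap1 μ (A ∩ ball x (R j)) (ball x (2 * R j))
  have hseq : Tendsto (fun j => ENNReal.ofReal (R j) * c j / μ (ball x (R j))) atTop (𝓝 0) :=
    hthin.comp (tendsto_nhdsWithin_iff.2 ⟨hR0, Eventually.of_forall hRpos⟩)
  have hev : ∀ᶠ j in atTop, c j ≠ ⊤ ∧ 3 * R j < dist z x := by
    have h3 : Tendsto (fun j => 3 * R j) atTop (𝓝 0) := by simpa using hR0.const_mul 3
    filter_upwards [hseq.eventually_lt_const ENNReal.zero_lt_top,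
      h3.eventually_lt_const (dist_pos.2 hz)] with j hj hjz
    refine ⟨fun htop => hj.ne ?_, hjz⟩
    rw [htop, ENNReal.mul_top (ENNReal.ofReal_pos.2 (hRpos j)).ne',
      ENNReal.top_div_of_ne_top (hX.measure_ball_lt_top x _).ne]
  have hV : ∀ j, ∃ V, IsOpen V ∧ A ∩ ball x (R j) ⊆ V ∧ ((c j ≠ ⊤ ∧ 3 * R j < dist z x) →
      ∀ r, 0 < r → R j ≤ 4 * r → ∀ S, S ∩ ball x r ⊆ V →
        vcap1 μ (S ∩ ball x r) (ball x (2 * r)) ≤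
          ENNReal.ofReal (1 + (1 + Cd ^ 3) * CP * 16) * (c j + μ (ball x (R j)))) := by
    intro j
    by_cases hj : c j ≠ ⊤ ∧ 3 * R j < dist z x
    · obtain ⟨V, hV, hAV, h⟩ := hX.exists_isOpen_superset_vcap1_le (hRpos j) hj.2
        (ENNReal.lt_add_right hj.1 (hX.measure_ball_pos x (hRpos j)).ne')
      exact ⟨V, hV, hAV, fun _ => h⟩
    · exact ⟨univ, isOpen_univ, subset_univ _, fun h => absurd h hj⟩
  choose V hVo hAV hVcap using hV
  obtain ⟨W, hW, hAW, hWV⟩ := exists_isOpen_superset_inter_ball_subset hxA hVo hAV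
  refine ⟨W, hW, hAW, ?_⟩
  set K : ℝ≥0∞ := ENNReal.ofReal (1 + (1 + Cd ^ 3) * CP * 16)
  set D : ℝ≥0∞ := ENNReal.ofReal Cd ^ 2
  have hlim : Tendsto (fun j => K * D * (ENNReal.ofReal (R j) * c j / μ (ball x (R j)) +
      ENNReal.ofReal (R j))) atTop (𝓝 0) := by
    have h1 : Tendsto (fun j => ENNReal.ofReal (R j)) atTop (𝓝 0) := by
      simpa using ENNReal.tendsto_ofReal hR0
    have h2 := ENNReal.Tendsto.const_mul (a := K * D) (hseq.add h1)
      (Or.inr (ENNReal.mul_ne_top ENNReal.ofReal_ne_top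
        (ENNReal.pow_ne_top ENNReal.ofReal_ne_top)))
    simpa using h2
  refine ENNReal.tendsto_nhds_zero.2 fun ε hε => ?_
  obtain ⟨N, hN⟩ := eventually_atTop.1 (hev.and (ENNReal.tendsto_nhds_zero.1 hlim ε hε))
  filter_upwards [Ioc_mem_nhdsGT (hRpos (N + 1))] with r hr
  obtain ⟨hr0, hrN⟩ := hr
  have hr1 : r ≤ 1 := hrN.trans (pow_le_one₀ (by norm_num) (by norm_num))
  obtain ⟨n, hn1, hn2⟩ := exists_nat_pow_near_of_lt_one hr0 hr1
    (by norm_num : (0 : ℝ) < 1 / 2) (by norm_num)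
  have hNn : N + 1 ≤ n := by
    by_contra! hlt
    exact absurd (hn1.trans_le hrN) (not_lt.2 (hRanti (by omega)))
  obtain ⟨j, rfl⟩ : ∃ j, n = j + 1 := ⟨n - 1, by omega⟩
  obtain ⟨hj, hjε⟩ := hN j (by omega)
  have hRr : R j ≤ 4 * r := by
    have : R j = 4 * (1 / 2) ^ (j + 1 + 1) := by simp only [hRdef]; ring
    rw [this]
    linarith
  have hball : μ (ball x (R j)) ≤ D * μ (ball x r) := by
    refine (measure_mono (ball_subset_ball ?_)).trans (hX.measure_ball_two_pow_mul_le x hr0 2)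
    linarith
  have hcap := hVcap j hj r hr0 hRr W
    ((inter_subset_inter_right W (ball_subset_ball hn2)).trans (hWV j))
  have hrR : r ≤ R j := hn2.trans (hRanti (Nat.le_succ j))
  have hm0 := (hX.measure_ball_pos x (hRpos j)).ne'
  have hmtop := (hX.measure_ball_lt_top x (R j)).ne
  refine le_trans ?_ hjε
  have hinv : (μ (ball x r))⁻¹ ≤ D * (μ (ball x (R j)))⁻¹ := by
    rw [← div_eq_mul_inv, ENNReal.le_div_iff_mul_le (Or.inl hm0) (Or.inl hmtop), mul_comm,
      ← div_eq_mul_inv]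
    exact ENNReal.div_le_of_le_mul hball
  calc ENNReal.ofReal r * vcap1 μ (W ∩ ball x r) (ball x (2 * r)) / μ (ball x r)
      ≤ ENNReal.ofReal (R j) * (K * (c j + μ (ball x (R j)))) *
          (D * (μ (ball x (R j)))⁻¹) := by
        rw [div_eq_mul_inv]
        gcongr
    _ = K * D * (ENNReal.ofReal (R j) * c j / μ (ball x (R j)) +
          ENNReal.ofReal (R j) * (μ (ball x (R j)) * (μ (ball x (R j)))⁻¹)) := by
        rw [div_eq_mul_inv]
        ring
    _ = _ := by rw [ENNReal.mul_inv_cancel hm0 hmtop, mul_one]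

end MetricBV
end
end

section
/- Let x ∈ X with cap₁({x}) > 0. Then the singleton {x} is 1-thick at x, i.e., limsup_{r→0} r · cap₁({x}, B(x,2r)) / μ(B(x,r)) > 0. -/
open MeasureTheory Metric Filter Set
open scoped ENNReal NNReal Topology

noncomputable section

namespace MetricBV

variable {X : Type*} [MetricSpace X] [MeasurableSpace X]

/-- A function whose increments are controlled by integrals of an integrable density is
continuous. -/
lemma continuousOn_of_ofReal_abs_sub_le_lintegral {f : ℝ → ℝ} {F : ℝ → ℝ≥0∞}
    (h : ∀ a b, 0 ≤ a → a ≤ b → b ≤ 1 →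
      ENNReal.ofReal |f b - f a| ≤ ∫⁻ t in Icc a b, F t)
    (hF : ∫⁻ t in Icc (0 : ℝ) 1, F t ≠ ⊤) : ContinuousOn f (Icc 0 1) := by
  rw [Metric.continuousOn_iff]
  intro a ha ε hε
  obtain ⟨δ, hδ, H⟩ := exists_pos_setLIntegral_lt_of_measure_lt hF
    (ε := ENNReal.ofReal ε) (by simpa using hε)
  obtain ⟨η, hη0, hη⟩ : ∃ η : ℝ, 0 < η ∧ ENNReal.ofReal η ≤ δ := by
    by_cases hδt : δ = ⊤
    · exact ⟨1, one_pos, by simp [hδt]⟩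
    · exact ⟨δ.toReal, ENNReal.toReal_pos hδ.ne' hδt, ENNReal.ofReal_toReal_le⟩
  have key : ∀ u ∈ Icc (0 : ℝ) 1, ∀ v ∈ Icc (0 : ℝ) 1, u ≤ v → v - u < η →
      |f v - f u| < ε := by
    intro u hu v hv huv hd
    have h1 := H (Icc u v) (lt_of_le_of_lt (Measure.restrict_apply_le _ _) (by
      rw [Real.volume_Icc]
      exact lt_of_lt_of_le ((ENNReal.ofReal_lt_ofReal_iff hη0).2 hd) hη))
    rw [Measure.restrict_restrict measurableSet_Icc,
      inter_eq_left.2 (Icc_subset_Icc hu.1 hv.2)] at h1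
    exact (ENNReal.ofReal_lt_ofReal_iff hε).1 ((h u v hu.1 huv hv.2).trans_lt h1)
  refine ⟨η, hη0, fun b hb hab => ?_⟩
  rw [Real.dist_eq] at hab ⊢
  rcases le_total a b with hle | hle
  · exact key a ha b hb hle ((le_abs_self _).trans_lt hab)
  · rw [abs_sub_comm]
    exact key b hb a ha hle ((le_abs_self _).trans_lt (by rwa [abs_sub_comm]))

lemma ofReal_clip_sub_le_lintegral {f : ℝ → ℝ} {F : ℝ → ℝ≥0∞}
    (h : ∀ a b, 0 ≤ a → a ≤ b → b ≤ 1 →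
      ENNReal.ofReal |f b - f a| ≤ ∫⁻ t in Icc a b, F t)
    (hF : ∫⁻ t in Icc (0 : ℝ) 1, F t ≠ ⊤) (α β : ℝ) :
    ENNReal.ofReal (max α (min (f 1) β) - max α (min (f 0) β)) ≤
      ∫⁻ t in Icc (0 : ℝ) 1, {t | α < f t ∧ f t < β}.indicator F t := by
  have hc := continuousOn_of_ofReal_abs_sub_le_lintegral h hF
  set p := max α (min (f 0) β) with hp
  set q := max α (min (f 1) β) with hq
  rcases le_or_gt q p with hqp | hpq
  · simp [ENNReal.ofReal_of_nonpos (sub_nonpos.2 hqp)]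
  have hαp : α ≤ p := le_max_left _ _
  have hαq : α < q := hαp.trans_lt hpq
  have hqf : q = min (f 1) β := by
    rcases max_choice α (min (f 1) β) with h' | h'
    · exact absurd (hq.trans h') hαq.ne'
    · exact hq.trans h'
  have hqβ : q ≤ β := hqf ▸ min_le_right _ _
  have hq1 : q ≤ f 1 := hqf ▸ min_le_left _ _
  have hp0 : f 0 ≤ p := by
    rcases min_choice (f 0) β with h' | h'
    · rw [hp, h']; exact le_max_right _ _
    · exact absurd ((le_max_right α (min (f 0) β)).trans_lt hpq) (by rw [h']; exact not_lt.2 hqβ)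
  obtain ⟨τ₁, ⟨hτ₁, hqτ₁⟩, hmin⟩ := (isCompact_Icc.of_isClosed_subset
    (hc.preimage_isClosed_of_isClosed isClosed_Icc isClosed_Ici) inter_subset_left :
    IsCompact (Icc (0 : ℝ) 1 ∩ f ⁻¹' Ici q)).exists_isLeast ⟨1, by simp, hq1⟩
  have hc' := hc.mono (Icc_subset_Icc_right hτ₁.2)
  obtain ⟨τ₀, ⟨hτ₀, hpτ₀⟩, hmax⟩ := (isCompact_Icc.of_isClosed_subset
    (hc'.preimage_isClosed_of_isClosed isClosed_Icc isClosed_Iic) inter_subset_left :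
    IsCompact (Icc (0 : ℝ) τ₁ ∩ f ⁻¹' Iic p)).exists_isGreatest ⟨0, by simp [hτ₁.1], hp0⟩
  have hqτ₁' : q ≤ f τ₁ := hqτ₁
  have hpτ₀' : f τ₀ ≤ p := hpτ₀
  calc ENNReal.ofReal (q - p) ≤ ENNReal.ofReal |f τ₁ - f τ₀| :=
        ENNReal.ofReal_le_ofReal ((by linarith : q - p ≤ f τ₁ - f τ₀).trans (le_abs_self _))
    _ ≤ ∫⁻ t in Icc τ₀ τ₁, F t := h τ₀ τ₁ hτ₀.1 hτ₀.2 hτ₁.2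
    _ = ∫⁻ t in Ioo τ₀ τ₁, F t := setLIntegral_congr Ioo_ae_eq_Icc.symm
    _ = ∫⁻ t in Ioo τ₀ τ₁, {t | α < f t ∧ f t < β}.indicator F t := by
        refine setLIntegral_congr_fun measurableSet_Ioo fun t ht => ?_
        have h1 : p < f t := by
          by_contra! hcon
          exact absurd (hmax ⟨⟨hτ₀.1.trans ht.1.le, ht.2.le⟩, hcon⟩) (not_le.2 ht.1)
        have h2 : f t < q := by
          by_contra! hcon
          exact absurd (hmin ⟨⟨hτ₀.1.trans ht.1.le, ht.2.le.trans hτ₁.2⟩, hcon⟩)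
            (not_le.2 ht.2)
        rw [indicator_of_mem]
        exact ⟨hαp.trans_lt h1, h2.trans_le hqβ⟩
    _ ≤ _ := lintegral_mono_set (Ioo_subset_Icc_self.trans (Icc_subset_Icc hτ₀.1 hτ₁.2))

/-- Increments of a truncation only see the part of the density that lies strictly between
the truncation levels. -/
lemma ofReal_abs_clip_sub_le_lintegral {f : ℝ → ℝ} {F : ℝ → ℝ≥0∞}
    (h : ∀ a b, 0 ≤ a → a ≤ b → b ≤ 1 →
      ENNReal.ofReal |f b - f a| ≤ ∫⁻ t in Icc a b, F t)
    (hF : ∫⁻ t in Icc (0 : ℝ) 1, F t ≠ ⊤) {α β : ℝ} (hαβ : α ≤ β) :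
    ENNReal.ofReal |max α (min (f 1) β) - max α (min (f 0) β)| ≤
      ∫⁻ t in Icc (0 : ℝ) 1, {t | α < f t ∧ f t < β}.indicator F t := by
  rcases abs_choice (max α (min (f 1) β) - max α (min (f 0) β)) with h' | h' <;> rw [h']
  · exact ofReal_clip_sub_le_lintegral h hF α β
  · have h2 := ofReal_clip_sub_le_lintegral (f := fun t => -f t) (F := F)
      (fun a b ha hab hb => by
        rw [show -f b - -f a = -(f b - f a) by ring, abs_neg]; exact h a b ha hab hb) hF (-β) (-α)
    have hclip : ∀ v : ℝ, max (-β) (min (-v) (-α)) = -max α (min v β) := by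
      intro v
      rw [min_neg_neg, max_neg_neg, max_comm v α]
      congr 1
      rw [max_min_distrib_left, max_eq_right hαβ, min_comm]
    have hset : {t | -β < -f t ∧ -f t < -α} = {t | α < f t ∧ f t < β} := by
      ext t; simp [and_comm]
    simp only [hclip, hset] at h2
    convert h2 using 2
    ring

omit [MeasurableSpace X] in
lemma speed_comp_affine (γ : ℝ → X) (a : ℝ) {c : ℝ} (hc : 0 < c) (t : ℝ) :
    speed (fun s => γ (a + c * s)) t = ENNReal.ofReal c * speed γ (a + c * t) := by
  unfold speed
  rw [← ENNReal.limsup_const_mul_of_ne_top ENNReal.ofReal_ne_top]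
  have hmap : Filter.map (fun h : ℝ => c * h) (𝓝[≠] (0 : ℝ)) = 𝓝[≠] 0 := by
    have := (Homeomorph.mulLeft₀ c hc.ne').map_punctured_nhds_eq (0 : ℝ)
    simpa using this
  conv_rhs => rw [← hmap, Filter.limsup, Filter.map_map]
  rw [Filter.limsup]
  congr 2
  funext h
  simp only [Function.comp]
  rw [← ENNReal.ofReal_mul hc.le, abs_mul, abs_of_pos hc]
  congr 1
  rw [show a + c * (t + h) = a + c * t + c * h by ring]
  rcases eq_or_ne h 0 with rfl | hh
  · simp
  · have := abs_pos.2 hh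
    field_simp

/-- The restriction of a curve to a subinterval, reparametrized over `[0,1]`. -/
def Curve.restrict (γ : Curve X) {a b : ℝ} (ha : 0 ≤ a) (hab : a ≤ b) (hb : b ≤ 1) : Curve X where
  toFun t := γ.toFun (a + (b - a) * t)
  lipschitz := by
    obtain ⟨K, hK⟩ := γ.lipschitz
    refine ⟨K, LipschitzOnWith.of_dist_le_mul fun s hs t ht => ?_⟩
    have hmem : ∀ s ∈ Icc (0 : ℝ) 1, a + (b - a) * s ∈ Icc (0 : ℝ) 1 := fun s hs =>
      ⟨by nlinarith [hs.1], by nlinarith [hs.2]⟩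
    refine (hK.dist_le_mul _ (hmem s hs) _ (hmem t ht)).trans ?_
    gcongr
    rw [Real.dist_eq, Real.dist_eq, show a + (b - a) * s - (a + (b - a) * t) = (b - a) * (s - t)
      by ring, abs_mul, abs_of_nonneg (sub_nonneg.2 hab)]
    exact mul_le_of_le_one_left (abs_nonneg _) (by linarith)

omit [MeasurableSpace X] in
lemma Curve.curveIntegral_restrict (γ : Curve X) {a b : ℝ} (ha : 0 ≤ a) (hab : a < b) (hb : b ≤ 1)
    (g : X → ℝ≥0∞) :
    curveIntegral g (γ.restrict ha hab.le hb) =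
      ∫⁻ t in Icc a b, g (γ.toFun t) * speed γ.toFun t := by
  have hpos : 0 < b - a := sub_pos.2 hab
  have himg : (fun t => a + (b - a) * t) '' Icc (0 : ℝ) 1 = Icc a b := by
    have := Set.image_affine_Icc' hpos a 0 1
    rw [show (fun t => a + (b - a) * t) = fun t => (b - a) * t + a by ext; ring, this]
    congr 1 <;> ring
  have := lintegral_image_eq_lintegral_abs_deriv_mul (s := Icc (0 : ℝ) 1)
    (f := fun t => a + (b - a) * t) (f' := fun _ => b - a) measurableSet_Icc
    (fun t _ => by
      simpa using (((hasDerivAt_id t).const_mul (b - a)).const_add a).hasDerivWithinAt)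
    (fun s _ t _ hst => by simpa [hpos.ne'] using hst)
    (fun t => g (γ.toFun t) * speed γ.toFun t)
  rw [himg] at this
  rw [this]
  unfold curveIntegral
  refine lintegral_congr fun t => ?_
  simp only [Curve.restrict]
  rw [speed_comp_affine γ.toFun a hpos t, abs_of_pos hpos]
  ring

omit [MeasurableSpace X] in
lemma Curve.speed_le (γ : Curve X) : ∃ K : ℝ≥0, ∀ t ∈ Ioo (0 : ℝ) 1, speed γ.toFun t ≤ K := by
  obtain ⟨K, hK⟩ := γ.lipschitz
  refine ⟨K, fun t ht => limsup_le_of_le ⟨0, by simp⟩ ?_⟩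
  have hev : ∀ᶠ h : ℝ in 𝓝 0, t + h ∈ Ioo (0 : ℝ) 1 := by
    have : Tendsto (fun h : ℝ => t + h) (𝓝 0) (𝓝 (t + 0)) := tendsto_const_nhds.add tendsto_id
    rw [add_zero] at this
    exact this (Ioo_mem_nhds ht.1 ht.2)
  filter_upwards [nhdsWithin_le_nhds hev, self_mem_nhdsWithin] with h hh hne
  have hpos : 0 < |h| := abs_pos.2 hne
  rw [← ENNReal.ofReal_coe_nnreal]
  refine ENNReal.ofReal_le_ofReal ((div_le_iff₀ hpos).2 ?_)
  have := hK.dist_le_mul _ (Ioo_subset_Icc_self hh) _ (Ioo_subset_Icc_self ht)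
  simpa [Real.dist_eq] using this

omit [MeasurableSpace X] in
/-- The length of a curve dominates the distance between its endpoints. -/
lemma Curve.ofReal_dist_le_lintegral_speed (γ : Curve X) {a b : ℝ} (ha : 0 ≤ a) (hab : a ≤ b)
    (hb : b ≤ 1) :
    ENNReal.ofReal (dist (γ.toFun b) (γ.toFun a)) ≤ ∫⁻ t in Icc a b, speed γ.toFun t := by
  obtain ⟨K, hK⟩ := γ.lipschitz
  set f : ℝ → ℝ := fun t => dist (γ.toFun t) (γ.toFun a) with hf
  have hsub : uIcc a b ⊆ Icc 0 1 := by rw [uIcc_of_le hab]; exact Icc_subset_Icc ha hb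
  have hfL : LipschitzOnWith K f (uIcc a b) := by
    refine LipschitzOnWith.of_dist_le_mul fun s hs t ht => ?_
    refine le_trans ?_ (hK.dist_le_mul s (hsub hs) t (hsub ht))
    rw [Real.dist_eq]
    exact abs_dist_sub_le _ _ _
  have hac := hfL.absolutelyContinuousOnInterval
  have hIntegral := hac.integral_deriv_eq_sub
  have hderiv : ∀ᵐ t, t ∈ Icc a b → ‖deriv f t‖ₑ ≤ speed γ.toFun t := by
    filter_upwards [hac.ae_differentiableAt] with t ht htm
    have hd := (ht (by rwa [uIcc_of_le hab])).hasDerivAt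
    rw [hasDerivAt_iff_tendsto_slope_zero] at hd
    rw [← hd.enorm.limsup_eq]
    refine limsup_le_limsup (Eventually.of_forall fun h => ?_)
    beta_reduce
    rw [← ofReal_norm, Real.norm_eq_abs, smul_eq_mul]
    refine ENNReal.ofReal_le_ofReal ?_
    calc |h⁻¹ * (f (t + h) - f t)| = |f (t + h) - f t| / |h| := by rw [abs_mul, abs_inv]; ring
      _ ≤ _ := by gcongr; exact abs_dist_sub_le _ _ _
  calc ENNReal.ofReal (dist (γ.toFun b) (γ.toFun a)) = ‖∫ t in Icc a b, deriv f t‖ₑ := by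
        rw [intervalIntegral.integral_of_le hab, ← integral_Icc_eq_integral_Ioc] at hIntegral
        rw [hIntegral]; simp [hf, ← ofReal_norm]
    _ ≤ ∫⁻ t in Icc a b, ‖deriv f t‖ₑ := enorm_integral_le_lintegral_enorm _
    _ ≤ _ := setLIntegral_mono_ae' measurableSet_Icc hderiv

omit [MeasurableSpace X] in
lemma IsUpperGradientOn.ofReal_abs_sub_le {g : X → ℝ≥0∞} {u : X → ℝ}
    (hg : IsUpperGradientOn g u univ) (γ : Curve X) {a b : ℝ} (ha : 0 ≤ a) (hab : a ≤ b)
    (hb : b ≤ 1) :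
    ENNReal.ofReal |u (γ.toFun b) - u (γ.toFun a)| ≤
      ∫⁻ t in Icc a b, g (γ.toFun t) * speed γ.toFun t := by
  rcases hab.eq_or_lt with rfl | hab'
  · simp
  · rw [← γ.curveIntegral_restrict ha hab' hb]
    have := hg (γ.restrict ha hab hb) (fun t _ => mem_univ _)
    simpa [Curve.restrict] using this

lemma exists_of_mod1_eq_zero {μ : Measure X} {Γ : Set (Curve X)} (hΓ : Mod1 μ Γ = 0)
    {ε : ℝ≥0∞} (hε : ε ≠ 0) :
    ∃ ρ : X → ℝ≥0∞, Measurable ρ ∧ (∀ γ ∈ Γ, 1 ≤ curveIntegral ρ γ) ∧ ∫⁻ y, ρ y ∂μ < ε := by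
  have h : Mod1 μ Γ < ε := hΓ ▸ pos_iff_ne_zero.2 hε
  simp only [Mod1, iInf_lt_iff] at h
  obtain ⟨ρ, h1, h2, h3⟩ := h
  exact ⟨ρ, h1, h2, h3⟩

lemma mod1_setOf_curveIntegral_eq_top {μ : Measure X} {g : X → ℝ≥0∞} (hgm : Measurable g)
    (hg : ∫⁻ y, g y ∂μ ≠ ⊤) : Mod1 μ {γ | curveIntegral g γ = ⊤} = 0 := by
  refine nonpos_iff_eq_zero.1 (ENNReal.le_of_forall_pos_le_add fun ε hε _ => ?_)
  set c : ℝ≥0∞ := ε / (∫⁻ y, g y ∂μ + 1) with hc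
  have hc0 : c ≠ 0 := (ENNReal.div_pos (by exact_mod_cast hε.ne') (by finiteness)).ne'
  refine (iInf₂_le_of_le (fun y => c * g y) (hgm.const_mul c)
    (iInf_le_of_le (fun γ hγ => ?_) le_rfl)).trans ?_
  · have h1 : c * curveIntegral g γ ≤ curveIntegral (fun y => c * g y) γ := by
      refine (lintegral_const_mul_le _ _).trans (le_of_eq ?_)
      simp only [curveIntegral, mul_assoc]
    rw [show curveIntegral g γ = ⊤ from hγ, ENNReal.mul_top hc0] at h1
    exact le_top.trans h1
  · rw [lintegral_const_mul _ hgm, zero_add]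
    calc c * ∫⁻ y, g y ∂μ ≤ c * (∫⁻ y, g y ∂μ + 1) := by gcongr; exact le_self_add
      _ = ε := ENNReal.div_mul_cancel (by simp) (by finiteness)

/-- A weak upper gradient of a function with values in `[0,1]` can be perturbed to a genuine
upper gradient. -/
lemma IsWeakUpperGradientOn.exists_isUpperGradientOn_add {μ : Measure X} {g : X → ℝ≥0∞}
    {u : X → ℝ} (hg : IsWeakUpperGradientOn μ g u univ) (hu : ∀ y, u y ∈ Icc (0 : ℝ) 1)
    {ε : ℝ≥0∞} (hε : ε ≠ 0) :
    ∃ ρ : X → ℝ≥0∞, Measurable ρ ∧ ∫⁻ y, ρ y ∂μ < ε ∧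
      IsUpperGradientOn (fun y => g y + ρ y) u univ := by
  obtain ⟨Γ, hΓ, h⟩ := hg
  obtain ⟨ρ, hρm, hρ, hρε⟩ := exists_of_mod1_eq_zero hΓ hε
  refine ⟨ρ, hρm, hρε, fun γ hγ => ?_⟩
  by_cases hmem : γ ∈ Γ
  · calc ENNReal.ofReal |u (γ.toFun 1) - u (γ.toFun 0)| ≤ ENNReal.ofReal 1 := by
          refine ENNReal.ofReal_le_ofReal (abs_le.2 ⟨?_, ?_⟩) <;>
            linarith [(hu (γ.toFun 1)).1, (hu (γ.toFun 1)).2, (hu (γ.toFun 0)).1,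
              (hu (γ.toFun 0)).2]
      _ ≤ curveIntegral ρ γ := by simpa using hρ γ hmem
      _ ≤ _ := curveIntegral_mono (fun y => le_add_self) γ
  · exact (h γ hmem hγ).trans (curveIntegral_mono (fun y => le_self_add) γ)

/-- The function `u` truncated between the levels `α` and `β` and rescaled to `[0,1]`. -/
def ramp (α β v : ℝ) : ℝ := (max α (min v β) - α) / (β - α)

lemma ramp_mem_Icc {α β : ℝ} (h : α < β) (v : ℝ) : ramp α β v ∈ Icc (0 : ℝ) 1 := by
  have hpos := sub_pos.2 h
  refine ⟨div_nonneg (sub_nonneg.2 (le_max_left _ _)) hpos.le, (div_le_one hpos).2 ?_⟩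
  exact sub_le_sub_right (max_le h.le (min_le_right _ _)) _

lemma ramp_eq_zero {α β v : ℝ} (hv : v ≤ α) : ramp α β v = 0 := by
  rw [ramp, max_eq_left ((min_le_left _ _).trans hv), sub_self, zero_div]

lemma ramp_eq_one {α β v : ℝ} (h : α < β) (hv : β ≤ v) : ramp α β v = 1 := by
  rw [ramp, min_eq_right hv, max_eq_right h.le, div_self (sub_pos.2 h).ne']

lemma continuous_ramp (α β : ℝ) : Continuous (ramp α β) := by
  unfold ramp; fun_prop

/-- Truncating a Lipschitz perturbation of `u` localizes its weak upper gradient to the set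
between the truncation levels. -/
lemma isWeakUpperGradientOn_ramp {μ : Measure X} {g : X → ℝ≥0∞} {u : X → ℝ}
    (hg : IsUpperGradientOn g u univ) (hgm : Measurable g) (hgi : ∫⁻ y, g y ∂μ ≠ ⊤)
    {α β c : ℝ} (h : α < β) (hc : 0 ≤ c) (x : X) {D : Set X}
    (hD : ∀ y, α < u y - c * dist y x → u y - c * dist y x < β → y ∈ D) :
    IsWeakUpperGradientOn μ
      (fun y => ENNReal.ofReal (β - α)⁻¹ * D.indicator (fun y => g y + ENNReal.ofReal c) y)
      (fun y => ramp α β (u y - c * dist y x)) univ := by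
  refine ⟨{γ | curveIntegral g γ = ⊤}, mod1_setOf_curveIntegral_eq_top hgm hgi,
    fun γ hγ _ => ?_⟩
  have hpos := sub_pos.2 h
  set f : ℝ → ℝ := fun t => u (γ.toFun t) - c * dist (γ.toFun t) x with hf
  set F : ℝ → ℝ≥0∞ := fun t => (g (γ.toFun t) + ENNReal.ofReal c) * speed γ.toFun t with hF
  have hinc : ∀ a b, 0 ≤ a → a ≤ b → b ≤ 1 →
      ENNReal.ofReal |f b - f a| ≤ ∫⁻ t in Icc a b, F t := by
    intro a b ha hab hb
    have h1 : |f b - f a| ≤ |u (γ.toFun b) - u (γ.toFun a)| +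
        c * dist (γ.toFun b) (γ.toFun a) := by
      rw [show f b - f a = (u (γ.toFun b) - u (γ.toFun a)) -
        c * (dist (γ.toFun b) x - dist (γ.toFun a) x) by simp only [hf]; ring]
      refine (abs_sub _ _).trans ?_
      rw [abs_mul, abs_of_nonneg hc]
      gcongr
      exact abs_dist_sub_le _ _ _
    calc ENNReal.ofReal |f b - f a| ≤ ENNReal.ofReal |u (γ.toFun b) - u (γ.toFun a)| +
          ENNReal.ofReal c * ENNReal.ofReal (dist (γ.toFun b) (γ.toFun a)) := by
          rw [← ENNReal.ofReal_mul hc, ← ENNReal.ofReal_add (abs_nonneg _) (by positivity)]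
          exact ENNReal.ofReal_le_ofReal h1
      _ ≤ (∫⁻ t in Icc a b, g (γ.toFun t) * speed γ.toFun t) +
          ∫⁻ t in Icc a b, ENNReal.ofReal c * speed γ.toFun t := by
          gcongr
          · exact hg.ofReal_abs_sub_le γ ha hab hb
          · refine le_trans ?_ (lintegral_const_mul_le _ _)
            gcongr
            exact γ.ofReal_dist_le_lintegral_speed ha hab hb
      _ ≤ _ := (le_lintegral_add _ _).trans (le_of_eq (by simp only [hF, add_mul]))
  have hfin : ∫⁻ t in Icc (0 : ℝ) 1, F t ≠ ⊤ := by
    obtain ⟨K, hK⟩ := γ.speed_le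
    have hle : ∫⁻ t in Icc (0 : ℝ) 1, F t ≤ curveIntegral g γ + ENNReal.ofReal c * K := by
      calc ∫⁻ t in Icc (0 : ℝ) 1, F t = ∫⁻ t in Ioo (0 : ℝ) 1, F t :=
            setLIntegral_congr Ioo_ae_eq_Icc.symm
        _ ≤ ∫⁻ t in Ioo (0 : ℝ) 1, (g (γ.toFun t) * speed γ.toFun t + ENNReal.ofReal c * K) := by
            refine setLIntegral_mono' measurableSet_Ioo fun t ht => ?_
            simp only [hF, add_mul]
            gcongr
            exact hK t ht
        _ = (∫⁻ t in Ioo (0 : ℝ) 1, g (γ.toFun t) * speed γ.toFun t) + ENNReal.ofReal c * K := by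
            rw [lintegral_add_right _ measurable_const]; simp
        _ ≤ _ := by
            gcongr
            exact lintegral_mono_set Ioo_subset_Icc_self
    exact ne_top_of_le_ne_top (by simpa using ⟨hγ, by finiteness⟩) hle
  have hclip := ofReal_abs_clip_sub_le_lintegral hinc hfin h.le
  calc ENNReal.ofReal |ramp α β (f 1) - ramp α β (f 0)|
      = ENNReal.ofReal (β - α)⁻¹ *
          ENNReal.ofReal |max α (min (f 1) β) - max α (min (f 0) β)| := by
        rw [← ENNReal.ofReal_mul (by positivity)]
        congr 1
        rw [ramp, ramp, ← sub_div, abs_div, abs_of_pos hpos, sub_sub_sub_cancel_right]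
        ring
    _ ≤ ENNReal.ofReal (β - α)⁻¹ * ∫⁻ t in Icc (0 : ℝ) 1,
          {t | α < f t ∧ f t < β}.indicator F t := by gcongr
    _ ≤ _ := by
        refine (lintegral_const_mul_le _ _).trans (lintegral_mono fun t => ?_)
        beta_reduce
        rw [mul_assoc]
        gcongr
        by_cases ht : α < f t ∧ f t < β
        · rw [indicator_of_mem (show t ∈ {t | α < f t ∧ f t < β} from ht),
            indicator_of_mem (hD _ ht.1 ht.2)]
        · rw [indicator_of_notMem (show t ∉ {t | α < f t ∧ f t < β} from ht)]
          exact zero_le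

omit [MetricSpace X] in
/-- Every function oscillating between `0` on `A` and `1` on `E` is far in mean from any
constant. -/
lemma min_measure_inter_le_lintegral {μ : Measure X} {w : X → ℝ} {A E B : Set X}
    (hw : AEMeasurable w μ) (hB : MeasurableSet B) (hA : ∀ y ∈ A, w y = 0)
    (hE : ∀ y ∈ E, w y = 1) (a : ℝ) :
    min (μ (B ∩ A)) (μ (B ∩ E)) ≤ 2 * ∫⁻ y in B, ENNReal.ofReal |w y - a| ∂μ := by
  have key : ∀ S : Set X, (∀ y ∈ S, 1 / 2 ≤ |w y - a|) →
      μ (B ∩ S) ≤ 2 * ∫⁻ y in B, ENNReal.ofReal |w y - a| ∂μ := by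
    intro S hS
    have hm : AEMeasurable (fun y => ENNReal.ofReal |w y - a|) (μ.restrict B) :=
      ((hw.sub_const a).abs.ennreal_ofReal).restrict
    have := meas_le_lintegral₀ (s := S) (hm.const_mul 2) (fun y hy => by
      rw [← ENNReal.ofReal_ofNat, ← ENNReal.ofReal_mul (by norm_num), ← ENNReal.ofReal_one]
      exact ENNReal.ofReal_le_ofReal (by linarith [hS y hy]))
    rwa [Measure.restrict_apply' hB, lintegral_const_mul' _ _ (by simp), inter_comm] at this
  rcases le_total (1 / 2) a with h | h
  · refine (min_le_left _ _).trans (key A fun y hy => ?_)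
    rw [hA y hy, zero_sub, abs_neg]
    exact h.trans (le_abs_self a)
  · refine (min_le_right _ _).trans (key E fun y hy => ?_)
    rw [hE y hy]
    exact (by linarith : 1 / 2 ≤ 1 - a).trans (le_abs_self _)

/-- Upper bound for the capacity of a point in terms of a function `u` with `u x = 1` and the
size of its superlevel set in a ball. -/
lemma cap1_singleton_le [BorelSpace X] {μ : Measure X} {g : X → ℝ≥0∞} {u : X → ℝ} {x : X}
    (hu : ∀ y, u y ≤ 1) (hx : u x = 1) (hum : AEMeasurable u μ)
    (hg : IsUpperGradientOn g u univ) (hgm : Measurable g) (hgi : ∫⁻ y, g y ∂μ ≠ ⊤)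
    {t s : ℝ} (ht0 : 0 ≤ t) (ht1 : t < 1) (hs : 0 < s) (hball : μ (ball x s) ≠ ⊤) :
    cap1 μ {x} ≤ μ (ball x s ∩ {y | t < u y}) + ENNReal.ofReal (1 - t)⁻¹ *
      ((∫⁻ y in ball x s \ {x}, g y ∂μ) +
        ENNReal.ofReal s⁻¹ * μ (ball x s ∩ {y | t < u y})) := by
  set S := ball x s ∩ {y | t < u y} with hS
  set D := (toMeasurable μ S ∩ ball x s) \ {x} with hD
  have hDm : MeasurableSet D :=
    ((measurableSet_toMeasurable _ _).inter measurableSet_ball).diff (measurableSet_singleton x)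
  have hSfin : μ S ≠ ⊤ := ne_top_of_le_ne_top hball (measure_mono inter_subset_left)
  have hmem : ∀ y, t < u y - s⁻¹ * dist y x → y ∈ S := by
    intro y hy
    have hd : 0 ≤ s⁻¹ * dist y x := by positivity
    refine ⟨?_, by show t < u y; linarith⟩
    have h1 : s⁻¹ * dist y x < 1 := by linarith [hu y]
    rwa [mem_ball, ← inv_mul_lt_one₀ hs]
  set v : X → ℝ := fun y => ramp t 1 (u y - s⁻¹ * dist y x) with hv
  set G : X → ℝ≥0∞ := fun y => ENNReal.ofReal (1 - t)⁻¹ *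
    D.indicator (fun y => g y + ENNReal.ofReal s⁻¹) y with hG
  have hGm : Measurable G := ((hgm.add_const _).indicator hDm).const_mul _
  have hvG : IsWeakUpperGradientOn μ G v univ := by
    refine isWeakUpperGradientOn_ramp hg hgm hgi ht1 (by positivity) x fun y h1 h2 =>
      ⟨⟨subset_toMeasurable _ _ (hmem y h1), (hmem y h1).1⟩, ?_⟩
    rintro rfl
    simp [hx] at h2
  have hvm : AEMeasurable v μ := (continuous_ramp t 1).measurable.comp_aemeasurable
    (hum.sub ((continuous_id.dist continuous_const).measurable.const_mul _).aemeasurable)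
  have hvint : ∫⁻ y, ENNReal.ofReal |v y| ∂μ ≤ μ S := by
    calc ∫⁻ y, ENNReal.ofReal |v y| ∂μ ≤ ∫⁻ y, (toMeasurable μ S).indicator 1 y ∂μ := by
          refine lintegral_mono fun y => ?_
          by_cases hy : t < u y - s⁻¹ * dist y x
          · rw [indicator_of_mem (subset_toMeasurable _ _ (hmem y hy))]
            have := ramp_mem_Icc ht1 (u y - s⁻¹ * dist y x)
            simpa [hv, abs_of_nonneg this.1] using this.2
          · simp [hv, ramp_eq_zero (not_lt.1 hy)]
      _ = μ S := by rw [lintegral_indicator_one (measurableSet_toMeasurable _ _),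
          measure_toMeasurable]
  have hGint : ∫⁻ y, G y ∂μ ≤ ENNReal.ofReal (1 - t)⁻¹ *
      ((∫⁻ y in ball x s \ {x}, g y ∂μ) + ENNReal.ofReal s⁻¹ * μ S) := by
    rw [hG, lintegral_const_mul _ ((hgm.add_const _).indicator hDm), lintegral_indicator hDm,
      lintegral_add_right _ measurable_const, lintegral_const, Measure.restrict_apply_univ]
    refine mul_le_mul_right (add_le_add (lintegral_mono_set (s := D)
      (t := ball x s \ {x}) fun y hy => ⟨hy.1.2, hy.2⟩)
      (mul_le_mul_right ?_ _)) _
    exact (measure_mono (sdiff_subset.trans inter_subset_left)).trans (measure_toMeasurable S).le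
  have hgfin : ∫⁻ y in ball x s \ {x}, g y ∂μ ≠ ⊤ :=
    ne_top_of_le_ne_top hgi (setLIntegral_le_lintegral _ _)
  have hmemN : MemN11 μ v := by
    refine ⟨⟨hvm.aestronglyMeasurable, ?_⟩, G, hGm, hvG, hGint.trans_lt (by finiteness)⟩
    rw [hasFiniteIntegral_iff_norm]
    exact hvint.trans_lt hSfin.lt_top
  refine (iInf₂_le_of_le v hmemN (iInf₂_le_of_le ?_ G (iInf₂_le_of_le hGm hvG le_rfl))).trans
    (add_le_add hvint hGint)
  rintro y rfl
  simp [hv, hx, ramp_eq_one ht1 le_rfl]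

namespace MMS

variable {μ : Measure X} {Cd CP lam : ℝ}

lemma measure_ball_pos_s12 (hX : MMS μ Cd CP lam) (x : X) {r : ℝ} (hr : 0 < r) :
    0 < μ (ball x r) := by
  simpa [mul_div_cancel₀] using (hX.doubling x (r / 2) (by positivity)).1

lemma measure_ball_ne_top (hX : MMS μ Cd CP lam) (x : X) (r : ℝ) : μ (ball x r) ≠ ⊤ :=
  ne_top_of_le_ne_top (hX.doubling x (max r 1) (by positivity)).2.2.ne
    (measure_mono (ball_subset_ball (le_max_left _ _)))

lemma isLocallyFiniteMeasure_s12 (hX : MMS μ Cd CP lam) : IsLocallyFiniteMeasure μ :=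
  ⟨fun x => ⟨ball x 1, ball_mem_nhds x one_pos, (hX.measure_ball_ne_top x 1).lt_top⟩⟩

lemma sigmaFinite (hX : MMS μ Cd CP lam) (x : X) : SigmaFinite μ :=
  ⟨⟨{ set := fun n => ball x n
      set_mem := fun _ => mem_univ _
      finite := fun n => (hX.measure_ball_ne_top x n).lt_top
      spanning := iUnion_ball_nat x }⟩⟩

lemma poincare_of_isWeakUpperGradientOn (hX : MMS μ Cd CP lam) {g : X → ℝ≥0∞} {u : X → ℝ}
    (hg : IsWeakUpperGradientOn μ g u univ) (hgm : Measurable g)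
    (hu : ∀ y, u y ∈ Icc (0 : ℝ) 1) (hum : AEMeasurable u μ) (x : X) {r : ℝ} (hr : 0 < r) :
    ∫⁻ y in ball x r, ENNReal.ofReal |u y - ⨍ z in ball x r, u z ∂μ| ∂μ ≤
      ENNReal.ofReal (CP * r) * ∫⁻ y in ball x (lam * r), g y ∂μ := by
  have := hX.isLocallyFiniteMeasure_s12
  have hC : ENNReal.ofReal (CP * r) ≠ 0 := by
    have := hX.hCP
    simpa using (by positivity : 0 < CP * r)
  refine ENNReal.le_of_forall_pos_le_add fun ε hε _ => ?_
  obtain ⟨ρ, hρm, hρ, hgρ⟩ := hg.exists_isUpperGradientOn_add hu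
    (ε := ε / ENNReal.ofReal (CP * r)) (ENNReal.div_pos (by exact_mod_cast hε.ne')
      ENNReal.ofReal_ne_top).ne'
  have hloc : LocallyIntegrable u μ :=
    (locallyIntegrable_const (1 : ℝ)).mono hum.aestronglyMeasurable (ae_of_all _ fun y => by
      simpa [abs_of_nonneg (hu y).1] using (hu y).2)
  calc _ ≤ _ := hX.poincare x r hr u hloc _ (hgm.add hρm) hgρ
    _ ≤ ENNReal.ofReal (CP * r) * 1 * ∫⁻ y in ball x (lam * r), (g y + ρ y) ∂μ := by
        refine mul_le_mul' (mul_le_mul_right ?_ _) le_rfl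
        refine ENNReal.div_le_of_le_mul ?_
        rw [one_mul]
        exact measure_mono (ball_subset_ball (le_mul_of_one_le_left hr.le hX.hlam))
    _ ≤ ENNReal.ofReal (CP * r) * ((∫⁻ y in ball x (lam * r), g y ∂μ) +
          ε / ENNReal.ofReal (CP * r)) := by
        rw [mul_one, lintegral_add_left hgm]
        gcongr
        exact (setLIntegral_le_lintegral _ _).trans hρ.le
    _ = _ := by rw [mul_add, ENNReal.mul_div_cancel hC ENNReal.ofReal_ne_top]

/-- A Poincaré inequality comparing a sublevel and a superlevel set through the part of the
upper gradient living between the two levels. -/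
lemma min_measure_sublevel_superlevel_le (hX : MMS μ Cd CP lam) [BorelSpace X]
    {g : X → ℝ≥0∞} {u : X → ℝ} (hum : AEMeasurable u μ) (hg : IsUpperGradientOn g u univ)
    (hgm : Measurable g) (hgi : ∫⁻ y, g y ∂μ ≠ ⊤) (x : X) {s α β : ℝ} (hs : 0 < s)
    (hαβ : α < β) :
    min (μ (ball x s ∩ {y | u y ≤ α})) (μ (ball x s ∩ {y | β ≤ u y})) ≤
      2 * (ENNReal.ofReal (CP * s) * (ENNReal.ofReal (β - α)⁻¹ *
        ∫⁻ y in ball x (lam * s) ∩ {y | α < u y ∧ u y < β}, g y ∂μ)) := by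
  set S := {y | α < u y ∧ u y < β} with hS
  have hSm : NullMeasurableSet S μ :=
    (nullMeasurableSet_lt aemeasurable_const hum).inter
      (nullMeasurableSet_lt hum aemeasurable_const)
  have hDm := measurableSet_toMeasurable μ S
  have hw := isWeakUpperGradientOn_ramp hg hgm hgi hαβ le_rfl x
    (D := toMeasurable μ S) (fun y h1 h2 => by
      rw [zero_mul, sub_zero] at h1 h2; exact subset_toMeasurable _ _ ⟨h1, h2⟩)
  simp only [zero_mul, sub_zero, ENNReal.ofReal_zero, add_zero] at hw
  have hwm : AEMeasurable (fun y => ramp α β (u y)) μ :=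
    (continuous_ramp α β).measurable.comp_aemeasurable hum
  have hP := hX.poincare_of_isWeakUpperGradientOn hw ((hgm.indicator hDm).const_mul _)
    (fun y => ramp_mem_Icc hαβ _) hwm x hs
  refine (min_measure_inter_le_lintegral (A := {y | u y ≤ α}) (E := {y | β ≤ u y}) hwm
    measurableSet_ball (fun y hy => ramp_eq_zero hy) (fun y hy => ramp_eq_one hαβ hy)
    (⨍ z in ball x s, ramp α β (u z) ∂μ)).trans ?_
  refine mul_le_mul_right (hP.trans (le_of_eq ?_)) 2
  rw [lintegral_const_mul _ (hgm.indicator hDm), setLIntegral_indicator hDm, inter_comm]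
  congr 2
  exact setLIntegral_congr ((ae_eq_refl _).inter hSm.toMeasurable_ae_eq)

end MMS

lemma tendsto_setLIntegral_ball_diff_singleton [BorelSpace X] {μ : Measure X} {g : X → ℝ≥0∞}
    (hgi : ∫⁻ y, g y ∂μ ≠ ⊤) (x : X) :
    Tendsto (fun s => ∫⁻ y in ball x s \ {x}, g y ∂μ) (𝓝[>] (0 : ℝ)) (𝓝 0) := by
  have hm : ∀ s, MeasurableSet (ball x s \ {x}) := fun s =>
    measurableSet_ball.diff (measurableSet_singleton x)
  have key := tendsto_measure_biInter_gt (μ := μ.withDensity g) (s := fun s => ball x s \ {x})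
    (a := (0 : ℝ)) (fun s _ => (hm s).nullMeasurableSet)
    (fun i j _ hij => sdiff_subset_sdiff_left (ball_subset_ball hij))
    ⟨1, one_pos, by
      rw [withDensity_apply _ (hm 1)]
      exact ne_top_of_le_ne_top hgi (setLIntegral_le_lintegral _ _)⟩
  have hempty : ⋂ s > (0 : ℝ), ball x s \ {x} = ∅ := by
    refine eq_empty_of_forall_notMem fun y hy => ?_
    simp only [mem_iInter] at hy
    have hyx : y ≠ x := (hy 1 one_pos).2
    exact lt_irrefl _ (mem_ball.1 (hy _ (dist_pos.2 hyx)).1)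
  rw [hempty, measure_empty] at key
  exact key.congr fun s => withDensity_apply _ (hm s)

omit [MetricSpace X] in
lemma setLIntegral_strip_eq {μ : Measure X} {g : X → ℝ≥0∞} {u : X → ℝ} (hum : AEMeasurable u μ)
    (h t : ℝ) :
    ∫⁻ y in {y | t < u y ∧ u y < t + h}, g y ∂μ =
      ∫⁻ y, {q : ℝ × X | q.1 < hum.mk u q.2 ∧ hum.mk u q.2 < q.1 + h}.indicator
        (fun q => g q.2) (t, y) ∂μ := by
  have hm := hum.measurable_mk
  refine Eq.trans ?_ (lintegral_indicator (s := {y | t < hum.mk u y ∧ hum.mk u y < t + h})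
    ((measurableSet_lt measurable_const hm).inter (measurableSet_lt hm measurable_const)) g).symm
  refine setLIntegral_congr ?_
  filter_upwards [hum.ae_eq_mk] with y hy
  exact propext (by
    show (t < u y ∧ u y < t + h) ↔ (t < hum.mk u y ∧ hum.mk u y < t + h)
    rw [hy])

omit [MetricSpace X] in
lemma measurable_indicator_strip {g : X → ℝ≥0∞} {u : X → ℝ} (hu : Measurable u)
    (hgm : Measurable g) (h : ℝ) :
    Measurable ({q : ℝ × X | q.1 < u q.2 ∧ u q.2 < q.1 + h}.indicator fun q => g q.2) :=
  (hgm.comp measurable_snd).indicator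
    ((measurableSet_lt measurable_fst (hu.comp measurable_snd)).inter
      (measurableSet_lt (hu.comp measurable_snd) (measurable_fst.add_const h)))

omit [MetricSpace X] in
lemma measurable_setLIntegral_strip {μ : Measure X} [SFinite μ] {g : X → ℝ≥0∞} {u : X → ℝ}
    (hum : AEMeasurable u μ) (hgm : Measurable g) (h : ℝ) :
    Measurable fun t : ℝ => ∫⁻ y in {y | t < u y ∧ u y < t + h}, g y ∂μ := by
  simp_rw [setLIntegral_strip_eq hum h]
  exact (measurable_indicator_strip hum.measurable_mk hgm h).lintegral_prod_right'

omit [MetricSpace X] in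
lemma lintegral_setLIntegral_strip {μ : Measure X} [SFinite μ] {g : X → ℝ≥0∞} {u : X → ℝ}
    (hum : AEMeasurable u μ) (hgm : Measurable g) (h : ℝ) :
    ∫⁻ t : ℝ, ∫⁻ y in {y | t < u y ∧ u y < t + h}, g y ∂μ = ENNReal.ofReal h * ∫⁻ y, g y ∂μ := by
  simp_rw [setLIntegral_strip_eq hum h]
  rw [lintegral_lintegral_swap (f := fun t y =>
      {q : ℝ × X | q.1 < hum.mk u q.2 ∧ hum.mk u q.2 < q.1 + h}.indicator (fun q => g q.2) (t, y))
    (measurable_indicator_strip hum.measurable_mk hgm h).aemeasurable,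
    ← lintegral_const_mul _ hgm]
  refine lintegral_congr fun y => ?_
  rw [show (fun t => {q : ℝ × X | q.1 < hum.mk u q.2 ∧ hum.mk u q.2 < q.1 + h}.indicator
      (fun q => g q.2) (t, y)) = (Ioo (hum.mk u y - h) (hum.mk u y)).indicator fun _ => g y from ?_,
    lintegral_indicator_const measurableSet_Ioo, Real.volume_Ioo, sub_sub_cancel, mul_comm]
  funext t
  simp only [indicator, mem_ofPred_eq, mem_Ioo]
  congr 1
  exact propext ⟨fun h => ⟨by linarith [h.2], h.1⟩, fun h => ⟨h.2, by linarith [h.1]⟩⟩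

namespace MMS

variable {μ : Measure X} {Cd CP lam : ℝ}

/-- At small scales, sublevel sets of a function attaining its maximum at a point of positive
capacity occupy only a small portion of the balls around this point. -/
lemma eventually_mul_measure_sublevel_lt (hX : MMS μ Cd CP lam) [BorelSpace X] {x : X}
    (hx : 0 < cap1 μ {x}) {g : X → ℝ≥0∞} {u : X → ℝ} (hu : ∀ y, u y ≤ 1) (hux : u x = 1)
    (hum : AEMeasurable u μ) (hg : IsUpperGradientOn g u univ) (hgm : Measurable g)
    (hgi : ∫⁻ y, g y ∂μ ≠ ⊤) {α : ℝ} (hα0 : 0 ≤ α) (hα1 : α < 1) {κ : ℝ≥0∞} (hκ1 : 1 ≤ κ)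
    (hκ : κ ≠ ⊤) :
    ∀ᶠ s in 𝓝[>] (0 : ℝ), κ * μ (ball x s ∩ {y | u y ≤ α}) < μ (ball x s) := by
  have hlam : 0 < lam := one_pos.trans_le hX.hlam
  obtain ⟨β, hαβ, hβ1⟩ := exists_between hα1
  set C := κ * (2 * (ENNReal.ofReal CP * ENNReal.ofReal (β - α)⁻¹)) with hC
  set M := C + ENNReal.ofReal (1 - β)⁻¹ * (1 + C) with hM
  have hMtop : M ≠ ⊤ := by finiteness
  have hscale : Tendsto (fun s => lam * s) (𝓝[>] (0 : ℝ)) (𝓝[>] (0 : ℝ)) := by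
    refine tendsto_nhdsWithin_iff.2 ⟨?_, ?_⟩
    · simpa using (tendsto_nhdsWithin_of_tendsto_nhds
        (by simpa using (continuous_const_mul lam).tendsto 0) :
          Tendsto (fun s => lam * s) (𝓝[>] (0 : ℝ)) (𝓝 0))
    · filter_upwards [self_mem_nhdsWithin] with s hs
      exact mul_pos hlam hs
  have hJ := ENNReal.Tendsto.const_mul
    ((tendsto_setLIntegral_ball_diff_singleton hgi x).comp hscale) (Or.inr hMtop)
  rw [mul_zero] at hJ
  filter_upwards [hJ.eventually_lt_const hx, Ioc_mem_nhdsGT one_pos] with s hlt hs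
  by_contra! hle
  set J := ∫⁻ y in ball x (lam * s) \ {x}, g y ∂μ with hJdef
  set b := μ (ball x s ∩ {y | β ≤ u y}) with hb
  have hbJ : b ≤ ENNReal.ofReal s * (C * J) := by
    have h1 := hX.min_measure_sublevel_superlevel_le hum hg hgm hgi x hs.1 hαβ
    have h2 : b ≤ κ * min (μ (ball x s ∩ {y | u y ≤ α})) b := by
      rcases le_total (μ (ball x s ∩ {y | u y ≤ α})) b with h | h
      · rw [min_eq_left h]
        exact (measure_mono inter_subset_left).trans hle
      · rw [min_eq_right h]
        exact le_mul_of_one_le_left' hκ1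
    have h3 : ∫⁻ y in ball x (lam * s) ∩ {y | α < u y ∧ u y < β}, g y ∂μ ≤ J :=
      lintegral_mono_set fun y hy => ⟨hy.1, by
        rintro rfl
        exact absurd hy.2.2 (by rw [hux]; exact hβ1.le.not_gt)⟩
    calc b ≤ κ * (2 * (ENNReal.ofReal (CP * s) * (ENNReal.ofReal (β - α)⁻¹ * J))) :=
          h2.trans (mul_le_mul_right (h1.trans (by gcongr)) _)
      _ = _ := by rw [ENNReal.ofReal_mul hX.hCP.le, hC]; ring
  have hS : μ (ball x s ∩ {y | β < u y}) ≤ b :=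
    measure_mono (inter_subset_inter_right _ fun y (hy : β < u y) => hy.le)
  have hcap := cap1_singleton_le hu hux hum hg hgm hgi (hα0.trans hαβ.le) hβ1 hs.1
    (hX.measure_ball_ne_top x s)
  refine hlt.not_ge (hcap.trans ?_)
  have hb1 : b ≤ C * J := hbJ.trans (mul_le_of_le_one_left' (ENNReal.ofReal_le_one.2 hs.2))
  have hb2 : ENNReal.ofReal s⁻¹ * b ≤ C * J := by
    refine (mul_le_mul_right hbJ _).trans_eq ?_
    rw [← mul_assoc, ← ENNReal.ofReal_mul (by simpa using hs.1.le), inv_mul_cancel₀ hs.1.ne',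
      ENNReal.ofReal_one, one_mul]
  have hJs : ∫⁻ y in ball x s \ {x}, g y ∂μ ≤ J :=
    lintegral_mono_set (sdiff_subset_sdiff_left (ball_subset_ball
      (le_mul_of_one_le_left hs.1.le hX.hlam)))
  calc _ ≤ C * J + ENNReal.ofReal (1 - β)⁻¹ * (J + C * J) := by
        refine add_le_add (hS.trans hb1) (mul_le_mul_right (add_le_add hJs ?_) _)
        exact (mul_le_mul_right hS _).trans hb2
    _ = M * J := by rw [hM]; ring

/-- Small spheres are nonempty, as a space supporting a Poincaré inequality is connected. -/
lemma eventually_exists_dist_eq (hX : MMS μ Cd CP lam) [BorelSpace X] (x : X) :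
    ∀ᶠ r in 𝓝[>] (0 : ℝ), ∃ y, dist y x = r := by
  have := hX.nontrivial
  obtain ⟨z, hz⟩ := exists_ne x
  filter_upwards [Ioo_mem_nhdsGT (dist_pos.2 hz)] with r hr
  by_contra! hne
  set u : X → ℝ := (ball x r).indicator fun _ => 1 with hu
  have hu1 : ∀ y ∈ ball x r, u y = 1 := fun y hy => indicator_of_mem hy _
  have hu0 : ∀ y, r ≤ dist y x → u y = 0 := fun y hy =>
    indicator_of_notMem (by simpa using hy) _
  have hug : IsUpperGradientOn (fun _ => 0) u univ := by
    intro γ _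
    obtain ⟨L, hL⟩ := γ.lipschitz
    have hc : ContinuousOn (fun t => dist (γ.toFun t) x) (Icc 0 1) :=
      (continuous_id.dist continuous_const).comp_continuousOn hL.continuousOn
    have hord := (isPreconnected_Icc.image _ hc).ordConnected
    have h0 : dist (γ.toFun 0) x ∈ (fun t => dist (γ.toFun t) x) '' Icc 0 1 :=
      mem_image_of_mem _ (left_mem_Icc.2 zero_le_one)
    have h1 : dist (γ.toFun 1) x ∈ (fun t => dist (γ.toFun t) x) '' Icc 0 1 :=
      mem_image_of_mem _ (right_mem_Icc.2 zero_le_one)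
    have hmiss : r ∉ (fun t => dist (γ.toFun t) x) '' Icc 0 1 := by
      rintro ⟨t, -, ht⟩
      exact hne _ ht
    have heq : u (γ.toFun 1) = u (γ.toFun 0) := by
      rcases lt_or_ge (dist (γ.toFun 0) x) r with h | h <;>
        rcases lt_or_ge (dist (γ.toFun 1) x) r with h' | h'
      · rw [hu1 _ h, hu1 _ h']
      · exact absurd (hord.out h0 h1 ⟨h.le, h'⟩) hmiss
      · exact absurd (hord.out h1 h0 ⟨h'.le, h⟩) hmiss
      · rw [hu0 _ h, hu0 _ h']
    simp [heq]
  have hmin := hX.min_measure_sublevel_superlevel_le (u := u) (g := fun _ => 0)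
    (measurable_const.indicator measurableSet_ball).aemeasurable hug measurable_const
    (by simp) x (s := 2 * dist z x) (α := 1 / 3) (β := 2 / 3) (by linarith [hr.1, hr.2])
    (by norm_num)
  simp only [lintegral_zero, mul_zero] at hmin
  refine hmin.not_gt (lt_min ?_ ?_)
  · refine (hX.measure_ball_pos_s12 z (sub_pos.2 hr.2)).trans_le (measure_mono fun y hy => ?_)
    rw [mem_ball] at hy
    refine ⟨?_, ?_⟩
    · rw [mem_ball]
      linarith [dist_triangle y z x, hr.1]
    · show u y ≤ 1 / 3
      rw [hu0 y (by linarith [dist_triangle_left z x y])]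
      norm_num
  · refine (hX.measure_ball_pos_s12 x hr.1).trans_le (measure_mono fun y hy => ⟨?_, ?_⟩)
    · rw [mem_ball] at hy ⊢
      linarith [hr.1, hr.2]
    · show 2 / 3 ≤ u y
      rw [hu1 y hy]
      norm_num

lemma measure_ball_two_mul_le (hX : MMS μ Cd CP lam) (x : X) {r : ℝ} (hr : 0 < r) :
    μ (ball x (2 * r)) ≤ ENNReal.ofReal Cd * μ (ball x r) :=
  (hX.doubling x r hr).2.1

lemma measure_ball_le_measure_annulus (hX : MMS μ Cd CP lam) {x y : X} {r : ℝ} (hr : 0 < r)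
    (hy : dist y x = 3 * r) :
    μ (ball x (4 * r)) ≤ ENNReal.ofReal Cd ^ 3 * μ (ball x (4 * r) \ ball x (2 * r)) := by
  have hsub : ball y r ⊆ ball x (4 * r) \ ball x (2 * r) := by
    intro z hz
    rw [mem_ball] at hz
    rw [Set.mem_sdiff, mem_ball, mem_ball, not_lt]
    exact ⟨by linarith [dist_triangle z y x], by linarith [dist_triangle_left y x z]⟩
  calc μ (ball x (4 * r)) ≤ μ (ball y (2 * (2 * (2 * r)))) :=
        measure_mono (ball_subset_ball' (by rw [dist_comm, hy]; linarith))
    _ ≤ ENNReal.ofReal Cd * (ENNReal.ofReal Cd * (ENNReal.ofReal Cd * μ (ball y r))) := by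
        refine (hX.measure_ball_two_mul_le y (by positivity)).trans (mul_le_mul_right ?_ _)
        refine (hX.measure_ball_two_mul_le y (by positivity)).trans (mul_le_mul_right ?_ _)
        exact hX.measure_ball_two_mul_le y hr
    _ ≤ ENNReal.ofReal Cd * (ENNReal.ofReal Cd * (ENNReal.ofReal Cd *
          μ (ball x (4 * r) \ ball x (2 * r)))) := by gcongr
    _ = _ := by ring

/-- Below the top level of a function attaining its maximum at a point of positive capacity,
some ball around the point is split into comparable parts by the level. -/
lemma exists_measure_ball_le_and_le (hX : MMS μ Cd CP lam) [BorelSpace X] {x : X}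
    (hx : 0 < cap1 μ {x}) {g : X → ℝ≥0∞} {u : X → ℝ} (hu : ∀ y, u y ≤ 1) (hux : u x = 1)
    (hum : AEMeasurable u μ) (hg : IsUpperGradientOn g u univ) (hgm : Measurable g)
    (hgi : ∫⁻ y, g y ∂μ ≠ ⊤) {α : ℝ} (hα0 : 0 ≤ α) (hα1 : α < 1) {κ : ℝ≥0∞}
    (hκ : 2 * ENNReal.ofReal Cd ≤ κ) (hκtop : κ ≠ ⊤) {R : ℝ} (hR : 0 < R)
    (hκR : μ (ball x R) ≤ κ * μ (ball x R ∩ {y | u y ≤ α})) :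
    ∃ s ∈ Ioc 0 R, μ (ball x s) ≤ κ * μ (ball x s ∩ {y | u y ≤ α}) ∧
      μ (ball x s) ≤ κ * μ (ball x s ∩ {y | α < u y}) := by
  have hCd : 1 ≤ ENNReal.ofReal Cd := ENNReal.one_le_ofReal.2 hX.hCd
  have hκ2 : 2 ≤ κ := (le_mul_of_one_le_right' hCd).trans hκ
  have hev := hX.eventually_mul_measure_sublevel_lt hx hu hux hum hg hgm hgi hα0 hα1
    (one_le_two.trans hκ2) hκtop
  have htend : Tendsto (fun n : ℕ => R * (1 / 2) ^ n) atTop (𝓝[>] (0 : ℝ)) := by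
    refine tendsto_nhdsWithin_iff.2 ⟨?_, Eventually.of_forall fun n => ?_⟩
    · simpa using (tendsto_pow_atTop_nhds_zero_of_lt_one (r := (1 / 2 : ℝ)) (by norm_num)
        (by norm_num)).const_mul R
    · exact mem_Ioi.2 (by positivity)
  have hex : ∃ n : ℕ, κ * μ (ball x (R * (1 / 2) ^ n) ∩ {y | u y ≤ α}) <
      μ (ball x (R * (1 / 2) ^ n)) := (htend.eventually hev).exists
  classical
  obtain ⟨j, hj⟩ : ∃ j, Nat.find hex = j + 1 := by
    refine Nat.exists_eq_succ_of_ne_zero fun h0 => ?_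
    have := Nat.find_spec hex
    rw [h0, pow_zero, mul_one] at this
    exact this.not_ge hκR
  have hlt := Nat.find_spec hex
  have hle := not_lt.1 (Nat.find_min hex (m := j) (by omega))
  rw [hj] at hlt
  set s := R * (1 / 2) ^ j with hs
  have hs0 : 0 < s := by positivity
  have hhalf : R * (1 / 2) ^ (j + 1) = s / 2 := by rw [hs, pow_succ]; ring
  rw [hhalf] at hlt
  refine ⟨s, ⟨hs0, ?_⟩, hle, ?_⟩
  · exact mul_le_of_le_one_right hR.le (pow_le_one₀ (by norm_num) (by norm_num))
  · set a := μ (ball x (s / 2) ∩ {y | u y ≤ α})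
    set b := μ (ball x (s / 2) ∩ {y | α < u y})
    have hsplit : μ (ball x (s / 2)) ≤ a + b := by
      refine (measure_mono fun y hy => ?_).trans (measure_union_le _ _)
      rcases le_or_gt (u y) α with h | h
      exacts [Or.inl ⟨hy, h⟩, Or.inr ⟨hy, h⟩]
    have hb : μ (ball x (s / 2)) ≤ 2 * b := by
      refine ENNReal.le_of_add_le_add_left (hX.measure_ball_ne_top x (s / 2)) ?_
      calc μ (ball x (s / 2)) + μ (ball x (s / 2)) ≤ (a + b) + (a + b) :=
            add_le_add hsplit hsplit
        _ = 2 * a + 2 * b := by ring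
        _ ≤ _ := by
          gcongr
          exact (mul_le_mul_left hκ2 a).trans hlt.le
    calc μ (ball x s) = μ (ball x (2 * (s / 2))) := by rw [mul_div_cancel₀ _ two_ne_zero]
      _ ≤ ENNReal.ofReal Cd * μ (ball x (s / 2)) :=
          hX.measure_ball_two_mul_le x (half_pos hs0)
      _ ≤ ENNReal.ofReal Cd * (2 * b) := by gcongr
      _ = 2 * ENNReal.ofReal Cd * b := by ring
      _ ≤ κ * μ (ball x s ∩ {y | α < u y}) := by
          refine mul_le_mul' hκ (measure_mono (inter_subset_inter_left _ (ball_subset_ball ?_)))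
          linarith

/-- A boxing inequality: the lower bound for `μ (ball x s) / s` is controlled by the energy of
functions that equal `1` at `x` and vanish outside a ball. -/
lemma le_mul_lintegral_of_isUpperGradientOn (hX : MMS μ Cd CP lam) [BorelSpace X] {x : X}
    (hx : 0 < cap1 μ {x}) {g : X → ℝ≥0∞} {u : X → ℝ} (hu : ∀ y, u y ≤ 1) (hux : u x = 1)
    (hum : AEMeasurable u μ) (hg : IsUpperGradientOn g u univ) (hgm : Measurable g)
    (hgi : ∫⁻ y, g y ∂μ ≠ ⊤) {κ : ℝ≥0∞} (hκ : 2 * ENNReal.ofReal Cd ≤ κ) (hκtop : κ ≠ ⊤)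
    {R : ℝ} (hR : 0 < R) (hκR : μ (ball x R) ≤ κ * μ (ball x R ∩ {y | u y ≤ 0}))
    {m : ℝ≥0∞} (hm : ∀ s ∈ Ioc 0 R, m * ENNReal.ofReal s ≤ μ (ball x s)) :
    m ≤ 4 * κ * ENNReal.ofReal CP * ∫⁻ y, g y ∂μ := by
  have := hX.sigmaFinite x
  set M := 4 * κ * ENNReal.ofReal CP with hM
  set h : ℕ → ℝ := fun n => 1 / ((n : ℝ) + 1) with hh
  have hpos : ∀ n, 0 < h n := fun n => Nat.one_div_pos_of_nat
  set F : ℕ → ℝ → ℝ≥0∞ := fun n t => M * (ENNReal.ofReal (h n)⁻¹ *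
    ∫⁻ y in {y | t < u y ∧ u y < t + h n}, g y ∂μ) with hF
  have hFm : ∀ n, Measurable (F n) := fun n =>
    ((measurable_setLIntegral_strip hum hgm (h n)).const_mul _).const_mul _
  have hlevel : ∀ t ∈ Ioo (0 : ℝ) 1, m ≤ liminf (fun n => F n t) atTop := by
    intro t ht
    obtain ⟨s, hs, hle, hge⟩ := hX.exists_measure_ball_le_and_le hx hu hux hum hg hgm hgi
      ht.1.le ht.2 hκ hκtop hR (hκR.trans (by
        gcongr
        exact ht.1.le))
    have hs0 := hs.1
    set S : ℕ → Set X := fun n => ball x s ∩ {y | t + h n ≤ u y} with hS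
    have hSmono : Monotone S := fun i j hij => inter_subset_inter_right _
      fun y (hy : t + h i ≤ u y) => (add_le_add_right (Nat.one_div_le_one_div hij) t).trans hy
    have hSunion : ⋃ n, S n = ball x s ∩ {y | t < u y} := by
      rw [hS, ← inter_iUnion]
      congr 1
      ext y
      refine mem_iUnion.trans ⟨fun ⟨n, hn⟩ => (lt_add_of_pos_right t (hpos n)).trans_le hn,
        fun hy => ?_⟩
      obtain ⟨n, hn⟩ := exists_nat_one_div_lt (sub_pos.2 (show t < u y from hy))
      exact ⟨n, by show t + h n ≤ u y; linarith⟩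
    have hlim := ENNReal.Tendsto.const_mul (a := 2 * κ)
      (tendsto_measure_iUnion_atTop (μ := μ) hSmono) (Or.inr (by finiteness))
    rw [hSunion] at hlim
    have hb : κ * μ (ball x s ∩ {y | t < u y}) ≠ ⊤ := ENNReal.mul_ne_top hκtop
      (ne_top_of_le_ne_top (hX.measure_ball_ne_top x s) (measure_mono inter_subset_left))
    have hgt : μ (ball x s) < 2 * κ * μ (ball x s ∩ {y | t < u y}) := by
      rw [mul_assoc, two_mul]
      exact hge.trans_lt (ENNReal.lt_add_right hb ((hX.measure_ball_pos_s12 x hs0).trans_le hge).ne')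
    refine le_liminf_of_le (by isBoundedDefault) ?_
    filter_upwards [hlim.eventually_const_lt hgt] with n hn
    have hP := hX.min_measure_sublevel_superlevel_le hum hg hgm hgi x hs0
      (lt_add_of_pos_right t (hpos n))
    rw [add_sub_cancel_left] at hP
    have hmin : μ (ball x s) ≤ 2 * κ * min (μ (ball x s ∩ {y | u y ≤ t})) (μ (S n)) := by
      rw [mul_min]
      refine le_min (hle.trans (mul_le_mul_left (le_mul_of_one_le_left' one_le_two) _)) hn.le
    refine (ENNReal.mul_le_mul_iff_left (ENNReal.ofReal_pos.2 hs0).ne' ENNReal.ofReal_ne_top).1 ?_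
    calc m * ENNReal.ofReal s ≤ μ (ball x s) := hm s hs
      _ ≤ 2 * κ * (2 * (ENNReal.ofReal (CP * s) * (ENNReal.ofReal (h n)⁻¹ *
            ∫⁻ y in {y | t < u y ∧ u y < t + h n}, g y ∂μ))) := by
          refine hmin.trans (mul_le_mul_right (hP.trans ?_) _)
          gcongr
          exact inter_subset_right
      _ = _ := by
          rw [ENNReal.ofReal_mul hX.hCP.le, hF, hM]
          ring
  have hIntegral : ∀ n, ∫⁻ t in Ioo (0 : ℝ) 1, F n t ≤ M * ∫⁻ y, g y ∂μ := by
    intro n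
    refine (setLIntegral_le_lintegral _ _).trans_eq ?_
    rw [hF, lintegral_const_mul _ ((measurable_setLIntegral_strip hum hgm (h n)).const_mul _),
      lintegral_const_mul _ (measurable_setLIntegral_strip hum hgm (h n)),
      lintegral_setLIntegral_strip hum hgm, ← mul_assoc (ENNReal.ofReal _),
      ← ENNReal.ofReal_mul (inv_nonneg.2 (hpos n).le), inv_mul_cancel₀ (hpos n).ne',
      ENNReal.ofReal_one, one_mul]
  calc m = ∫⁻ _ in Ioo (0 : ℝ) 1, m := by simp
    _ ≤ ∫⁻ t in Ioo (0 : ℝ) 1, liminf (fun n => F n t) atTop :=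
        setLIntegral_mono' measurableSet_Ioo hlevel
    _ ≤ liminf (fun n => ∫⁻ t in Ioo (0 : ℝ) 1, F n t) atTop := lintegral_liminf_le hFm
    _ ≤ liminf (fun _ : ℕ => M * ∫⁻ y, g y ∂μ) atTop :=
        liminf_le_liminf (Eventually.of_forall hIntegral)
    _ = _ := liminf_const _

lemma le_mul_vcap1 (hX : MMS μ Cd CP lam) [BorelSpace X] {x : X} (hx : 0 < cap1 μ {x})
    {κ : ℝ≥0∞} (hκ : 2 * ENNReal.ofReal Cd ≤ κ) (hκtop : κ ≠ ⊤) {r R : ℝ} (hR : 0 < R)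
    (hκR : μ (ball x R) ≤ κ * μ (ball x R \ ball x r)) {m : ℝ≥0∞}
    (hm : ∀ s ∈ Ioc 0 R, m * ENNReal.ofReal s ≤ μ (ball x s)) :
    m ≤ 4 * κ * ENNReal.ofReal CP * vcap1 μ {x} (ball x r) := by
  set M := 4 * κ * ENNReal.ofReal CP with hM
  have hMtop : M ≠ ⊤ := by finiteness
  have hκ0 : κ ≠ 0 := fun h => by
    rw [h, nonpos_iff_eq_zero, mul_eq_zero, ENNReal.ofReal_eq_zero] at hκ
    exact hκ.elim two_ne_zero fun h => by linarith [hX.hCd]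
  have hM0 : M ≠ 0 := mul_ne_zero (mul_ne_zero four_ne_zero hκ0) (ENNReal.ofReal_pos.2 hX.hCP).ne'
  rw [← ENNReal.div_le_iff' hM0 hMtop]
  refine le_iInf₂ fun u hu => le_iInf₂ fun hux hoff => le_iInf₂ fun g hgm => le_iInf fun hg => ?_
  rw [ENNReal.div_le_iff' hM0 hMtop]
  by_cases hgi : ∫⁻ y, g y ∂μ = ⊤
  · rw [hgi, ENNReal.mul_top hM0]
    exact le_top
  set v : X → ℝ := fun y => ramp 0 1 (u y) with hv
  have hv01 : ∀ y, v y ∈ Icc (0 : ℝ) 1 := fun y => ramp_mem_Icc zero_lt_one _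
  have hvm : AEMeasurable v μ :=
    (continuous_ramp 0 1).measurable.comp_aemeasurable hu.1.aestronglyMeasurable.aemeasurable
  have hvg : IsWeakUpperGradientOn μ g v univ := by
    obtain ⟨Γ, hΓ, hΓg⟩ := hg
    refine ⟨Γ, hΓ, fun γ hγ hin => le_trans (ENNReal.ofReal_le_ofReal ?_) (hΓg γ hγ hin)⟩
    simp only [hv, ramp, sub_zero, div_one]
    exact (abs_max_sub_max_le_max _ _ _ _).trans (by
      simpa using (abs_min_sub_min_le_max (u (γ.toFun 1)) 1 (u (γ.toFun 0)) 1))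
  refine ENNReal.le_of_forall_pos_le_add fun ε hε _ => ?_
  obtain ⟨ρ, hρm, hρ, hgρ⟩ := hvg.exists_isUpperGradientOn_add hv01 (ε := ε / M)
    (ENNReal.div_pos (by exact_mod_cast hε.ne') hMtop).ne'
  have hadd : ∫⁻ y, (g y + ρ y) ∂μ = ∫⁻ y, g y ∂μ + ∫⁻ y, ρ y ∂μ := lintegral_add_left hgm _
  have hsub : ball x R \ ball x r ⊆ ball x R ∩ {y | v y ≤ 0} := fun y hy =>
    ⟨hy.1, (ramp_eq_zero (hoff y hy.2).le).le⟩
  calc m ≤ M * ∫⁻ y, (g y + ρ y) ∂μ := by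
        refine hX.le_mul_lintegral_of_isUpperGradientOn hx (fun y => (hv01 y).2)
          (ramp_eq_one zero_lt_one (hux x rfl)) hvm hgρ (hgm.add hρm) ?_ hκ hκtop hR
          (hκR.trans (mul_le_mul_right (measure_mono hsub) _)) hm
        rw [hadd]
        exact ENNReal.add_ne_top.2 ⟨hgi, hρ.ne_top⟩
    _ ≤ M * (∫⁻ y, g y ∂μ + ε / M) := by
        rw [hadd]
        gcongr
    _ = _ := by rw [mul_add, ENNReal.mul_div_cancel hM0 hMtop]

lemma cap1_singleton_mul_le (hX : MMS μ Cd CP lam) [BorelSpace X] (x : X) {s : ℝ}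
    (hs : s ∈ Ioc (0 : ℝ) 1) : cap1 μ {x} * ENNReal.ofReal s ≤ 2 * μ (ball x s) := by
  have h := cap1_singleton_le (μ := μ) (u := fun _ => 1) (g := fun _ => 0) (x := x)
    (fun _ => le_rfl) rfl aemeasurable_const (fun γ _ => by simp) measurable_const (by simp)
    le_rfl zero_lt_one hs.1 (hX.measure_ball_ne_top x s)
  simp only [sub_zero, inv_one, ENNReal.ofReal_one, one_mul, lintegral_zero, zero_add,
    zero_lt_one, ofPred_true, inter_univ] at h
  calc cap1 μ {x} * ENNReal.ofReal s
      ≤ (μ (ball x s) + ENNReal.ofReal s⁻¹ * μ (ball x s)) * ENNReal.ofReal s := by gcongr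
    _ = ENNReal.ofReal s * μ (ball x s) +
          ENNReal.ofReal s * ENNReal.ofReal s⁻¹ * μ (ball x s) := by ring
    _ ≤ 1 * μ (ball x s) + 1 * μ (ball x s) := by
        rw [← ENNReal.ofReal_mul hs.1.le, mul_inv_cancel₀ hs.1.ne', ENNReal.ofReal_one]
        gcongr
        exact ENNReal.ofReal_le_one.2 hs.2
    _ = _ := by ring

end MMS

/-- **Points of positive capacity are thick.** If `cap₁({x}) > 0`, then `{x}` is 1-thick at
`x`, i.e. `limsup_{r→0} r · cap₁({x}, B(x,2r)) / μ(B(x,r)) > 0`. -/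
theorem positive_capacity_implies_thickness
    {X : Type*} [MetricSpace X] [MeasurableSpace X] [BorelSpace X]
    (μ : Measure X) (Cd CP lam : ℝ) (hX : MMS μ Cd CP lam)
    (x : X) (hx : 0 < cap1 μ {x}) :
    0 < Filter.limsup (fun r : ℝ =>
        ENNReal.ofReal r * vcap1 μ {x} (Metric.ball x (2 * r)) / μ (Metric.ball x r))
      (𝓝[>] (0 : ℝ)) := by
  have hCd : 1 ≤ ENNReal.ofReal Cd := ENNReal.one_le_ofReal.2 hX.hCd
  set κ := 2 * ENNReal.ofReal Cd ^ 3 with hκ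
  have hκtop : κ ≠ ⊤ := by finiteness
  have hκ0 : κ ≠ 0 := mul_ne_zero two_ne_zero (pow_ne_zero _ (one_pos.trans_le hCd).ne')
  set M := 4 * κ * ENNReal.ofReal CP with hM
  have hMtop : M ≠ ⊤ := by finiteness
  have hM0 : M ≠ 0 := mul_ne_zero (mul_ne_zero four_ne_zero hκ0) (ENNReal.ofReal_pos.2 hX.hCP).ne'
  have hM8 : (8 * M)⁻¹ * (8 * M) = 1 :=
    ENNReal.inv_mul_cancel (mul_ne_zero (by norm_num) hM0) (by finiteness)
  refine (ENNReal.inv_pos.2 (by finiteness : 8 * M ≠ ⊤)).trans_le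
    (le_limsup_of_frequently_le' (frequently_iff.2 fun {U} hU => ?_))
  obtain ⟨δ, hδ, hδU⟩ := mem_nhdsGT_iff_exists_Ioo_subset.1
    (inter_mem hU (hX.eventually_exists_dist_eq x))
  obtain ⟨R, hR0, hR⟩ := exists_between (lt_min one_pos (mem_Ioi.1 hδ))
  have hR1 := (hR.trans_le (min_le_left _ _)).le
  have hRδ := hR.trans_le (min_le_right _ _)
  set φ : ℝ → ℝ≥0∞ := fun s => μ (ball x s) / ENNReal.ofReal s with hφ
  set m := ⨅ s ∈ Ioc 0 R, φ s with hm
  have hle : ∀ s ∈ Ioc 0 R, m ≤ φ s := fun s hs => iInf₂_le s hs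
  have hm0 : 0 < m := by
    refine (ENNReal.half_pos hx.ne').trans_le (le_iInf₂ fun s hs => ?_)
    rw [hφ, ENNReal.le_div_iff_mul_le (Or.inl (ENNReal.ofReal_pos.2 hs.1).ne')
      (Or.inl ENNReal.ofReal_ne_top), ← ENNReal.mul_div_right_comm]
    exact ENNReal.div_le_of_le_mul' (hX.cap1_singleton_mul_le x ⟨hs.1, hs.2.trans hR1⟩)
  have hmtop : m ≠ ⊤ := ne_top_of_le_ne_top (ENNReal.div_ne_top (hX.measure_ball_ne_top x R)
    (ENNReal.ofReal_pos.2 hR0).ne') (hle R ⟨hR0, le_rfl⟩)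
  obtain ⟨s, hs, hφs⟩ : ∃ s ∈ Ioc 0 R, φ s < m + m := by
    simpa only [hm, iInf_lt_iff, exists_prop] using ENNReal.lt_add_right hmtop hm0.ne'
  obtain ⟨r, rfl⟩ : ∃ r, s = 4 * r := ⟨s / 4, by ring⟩
  have hr : 0 < r := by linarith [hs.1]
  obtain ⟨y, hy⟩ := (hδU (show 3 * r ∈ Ioo 0 δ from ⟨by linarith, by linarith [hs.2]⟩)).2
  refine ⟨r, (hδU ⟨hr, by linarith [hs.2]⟩).1, ?_⟩
  have hmV : m ≤ M * vcap1 μ {x} (ball x (2 * r)) := by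
    refine hX.le_mul_vcap1 hx (mul_le_mul_right (le_self_pow hCd three_ne_zero) 2) hκtop
      hs.1 ((hX.measure_ball_le_measure_annulus hr hy).trans
        (mul_le_mul_left (le_mul_of_one_le_left' one_le_two) _)) fun s' hs' => ?_
    exact (ENNReal.le_div_iff_mul_le (Or.inl (ENNReal.ofReal_pos.2 hs'.1).ne')
      (Or.inl ENNReal.ofReal_ne_top)).1 (hle s' ⟨hs'.1, hs'.2.trans hs.2⟩)
  have hball : μ (ball x r) ≤ (m + m) * ENNReal.ofReal (4 * r) :=
    (measure_mono (ball_subset_ball (by linarith))).trans ((ENNReal.div_le_iff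
      (ENNReal.ofReal_pos.2 hs.1).ne' ENNReal.ofReal_ne_top).1 hφs.le)
  rw [ENNReal.le_div_iff_mul_le (Or.inl (hX.measure_ball_pos_s12 x hr).ne')
    (Or.inl (hX.measure_ball_ne_top x r))]
  set V := vcap1 μ {x} (ball x (2 * r))
  calc (8 * M)⁻¹ * μ (ball x r) ≤ (8 * M)⁻¹ * ((M * V + M * V) * ENNReal.ofReal (4 * r)) := by
        gcongr
        exact hball.trans (by gcongr)
    _ = (8 * M)⁻¹ * (8 * M) * (ENNReal.ofReal r * V) := by
        rw [ENNReal.ofReal_mul (by norm_num), ENNReal.ofReal_ofNat]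
        ring
    _ = _ := by rw [hM8, one_mul]

end MetricBV
end
end
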